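/- Let 1 ≤ a < b be fixed real algebraic numbers such that a/b is irrational, and let ε > 0. Then for all real x ≥ 2 and H ≥ 2, Σ_{1 ≤ h ≤ bH} (1/h) · min( h^{−1/2} x^{1/(2(a+b))}, 1/‖(a/b)h‖ + 1/‖(b/a)h‖ ) ≪ x^{1/(3(a+b))} H^ε, where h ranges over positive integers, ‖t‖ denotes the distance from the real number t to the nearest integer, and the implied constant depends only on a, b, ε. -/

import Mathlib

open Real

/-- `‖t‖`: the distance from the real number `t` to the nearest integer. -/
noncomputable def nearestIntDist (t : ℝ) : ℝ := min (Int.fract t) (1 - Int.fract t)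

namespace RothAux
open MvPolynomial

/-- product of binomial coefficients -/
def bin {n : ℕ} (δ e : Fin n →₀ ℕ) : ℕ := ∏ j, (e j).choose (δ j)

/-- diagonal (Hasse-type) operator: `x^e ↦ binom(e, δ) x^e`. -/
noncomputable def Top {n : ℕ} {R : Type*} [CommRing R] (δ : Fin n →₀ ℕ)
    (f : MvPolynomial (Fin n) R) : MvPolynomial (Fin n) R :=
  ∑ e ∈ f.support, monomial e ((bin δ e : R) * coeff e f)

lemma coeff_Top {n : ℕ} {R : Type*} [CommRing R] (δ : Fin n →₀ ℕ)
    (f : MvPolynomial (Fin n) R) (e : Fin n →₀ ℕ) :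
    coeff e (Top δ f) = (bin δ e : R) * coeff e f := by
  classical
  unfold Top
  rw [coeff_sum]
  simp only [coeff_monomial]
  rw [Finset.sum_ite_eq' f.support e]
  split_ifs with h
  · rfl
  · rw [notMem_support_iff.mp h, mul_zero]

lemma Top_sum_smul {n : ℕ} {R ι : Type*} [CommRing R] (δ : Fin n →₀ ℕ) (s : Finset ι)
    (c : ι → R) (f : ι → MvPolynomial (Fin n) R) :
    Top δ (∑ l ∈ s, c l • f l) = ∑ l ∈ s, c l • Top δ (f l) := by
  ext e
  simp only [coeff_Top, coeff_sum, coeff_smul, smul_eq_mul, Finset.mul_sum]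
  exact Finset.sum_congr rfl fun i _ => by ring

lemma Top_map {n : ℕ} {R S : Type*} [CommRing R] [CommRing S] (g : R →+* S) (δ : Fin n →₀ ℕ)
    (f : MvPolynomial (Fin n) R) : Top δ (map g f) = map g (Top δ f) := by
  ext e
  simp [coeff_Top, coeff_map]

lemma bin_succ {n : ℕ} (δ e : Fin n →₀ ℕ) (l : Fin n) :
    (δ l + 1) * bin (δ + Finsupp.single l 1) e + δ l * bin δ e = e l * bin δ e := by
  classical
  have h1 : bin δ e = (e l).choose (δ l) * ∏ j ∈ Finset.univ.erase l, (e j).choose (δ j) :=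
    (Finset.mul_prod_erase _ _ (Finset.mem_univ l)).symm
  have h2 : bin (δ + Finsupp.single l 1) e
      = (e l).choose (δ l + 1) * ∏ j ∈ Finset.univ.erase l, (e j).choose (δ j) := by
    unfold bin
    rw [← Finset.mul_prod_erase _ _ (Finset.mem_univ l)]
    congr 1
    · simp
    · refine Finset.prod_congr rfl fun j hj => ?_
      have : l ≠ j := (Finset.ne_of_mem_erase hj).symm
      simp [this]
  rw [h1, h2]
  generalize ∏ j ∈ Finset.univ.erase l, (e j).choose (δ j) = A
  have h3 := Nat.choose_succ_right_eq (e l) (δ l)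
  rcases le_or_gt (δ l) (e l) with h | h
  · obtain ⟨t, ht⟩ := Nat.exists_eq_add_of_le h
    rw [ht] at h3 ⊢
    rw [Nat.add_sub_cancel_left] at h3
    have : (δ l + 1) * ((δ l + t).choose (δ l + 1) * A) = ((δ l + t).choose (δ l) * t) * A := by
      rw [← h3]; ring
    rw [this]; ring
  · rw [Nat.choose_eq_zero_of_lt h, Nat.choose_eq_zero_of_lt (by omega)]; simp

lemma sep {n : ℕ} {K : Type*} [Field K] : ∀ (N : ℕ) (s : Finset (Fin n →₀ ℕ)), s.card = N →
    ∀ w : (Fin n →₀ ℕ) → K, (CharZero K) →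
    (∀ δ : Fin n →₀ ℕ, (∑ j, δ j) + 1 ≤ N → ∑ e ∈ s, w e * (bin δ e : K) = 0) →
    ∀ e ∈ s, w e = 0 := by
  classical
  intro N
  induction N with
  | zero =>
    intro s hs w _ _ e he
    rw [Finset.card_eq_zero] at hs
    simp [hs] at he
  | succ N ih =>
    intro s hs w hc h e0 he0
    by_cases hN : N = 0
    · subst hN
      obtain ⟨x, hx⟩ := Finset.card_eq_one.mp hs
      subst hx
      have := h 0 (by simp)
      simp [bin] at this
      simp at he0
      rw [he0]; exact this
    · obtain ⟨e1, he1, hne⟩ := Finset.exists_mem_ne (s := s) (by omega) e0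
      obtain ⟨l, hl⟩ : ∃ l, e0 l ≠ e1 l := by
        by_contra! hcon
        exact hne (Finsupp.ext hcon).symm
      have key := ih (s.erase e1) (by rw [Finset.card_erase_of_mem he1, hs]; rfl)
        (fun e => w e * ((e l : K) - (e1 l : K))) hc ?_ e0 (Finset.mem_erase.mpr ⟨hne.symm, he0⟩)
      · rcases mul_eq_zero.mp key with h0 | h0
        · exact h0
        · exfalso
          rw [sub_eq_zero] at h0
          exact hl (by exact_mod_cast h0)
      · intro δ hδ
        have hsum : ∑ e ∈ s.erase e1, w e * ((e l : K) - (e1 l : K)) * (bin δ e : K)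
            = ∑ e ∈ s, w e * ((e l : K) - (e1 l : K)) * (bin δ e : K) := by
          rw [← Finset.add_sum_erase s _ he1]; simp
        rw [hsum]
        have e1' := h δ (by omega)
        have e2' := h (δ + Finsupp.single l 1) (by
          simp only [Finsupp.add_apply, Finset.sum_add_distrib]
          have : ∑ j, (Finsupp.single l 1 : Fin n →₀ ℕ) j = 1 := by
            simp [Finsupp.single_apply]
          omega)
        have : ∀ e, w e * ((e l : K) - (e1 l : K)) * (bin δ e : K)
            = ((δ l : K) + 1) * (w e * (bin (δ + Finsupp.single l 1) e : K))
              + ((δ l : K) - e1 l) * (w e * (bin δ e : K)) := by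
          intro e
          have hb : (((δ l + 1) * bin (δ + Finsupp.single l 1) e + δ l * bin δ e : ℕ) : K)
              = ((e l * bin δ e : ℕ) : K) := by rw [bin_succ]
          push_cast at hb
          linear_combination (-(w e)) * hb
        simp_rw [this]
        rw [Finset.sum_add_distrib, ← Finset.mul_sum, ← Finset.mul_sum, e1', e2']
        simp

lemma exists_bin_det {n k : ℕ} {K : Type*} [Field K] [CharZero K] (e : Fin k → (Fin n →₀ ℕ))
    (he : Function.Injective e) :
    ∃ δ : Fin k → (Fin n →₀ ℕ), (∀ i, (∑ j, δ i j) + 1 ≤ k) ∧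
      (Matrix.of fun i j => (bin (δ i) (e j) : K)).det ≠ 0 := by
  classical
  let v : (Fin n →₀ ℕ) → (Fin k → K) := fun δ j => (bin δ (e j) : K)
  let S : Set (Fin k → K) := Set.image v {δ | (∑ j, δ j) + 1 ≤ k}
  have hS : Submodule.span K S = ⊤ := by
    by_contra hne
    obtain ⟨f, hf0, hf⟩ := Submodule.exists_le_ker_of_lt_top _ (lt_top_iff_ne_top.mpr hne)
    apply hf0
    have hfe : ∀ x, f x = ∑ j, x j * f (Pi.single j 1) := by
      intro x
      conv_lhs => rw [pi_eq_sum_univ' x]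
      simp
    let w : (Fin n →₀ ℕ) → K := fun d => ∑ j, if e j = d then f (Pi.single j 1) else 0
    have hw : ∀ j, w (e j) = f (Pi.single j 1) := by
      intro j
      simp [w, he.eq_iff]
    have := sep k (Finset.univ.image e)
      (by rw [Finset.card_image_of_injective _ he]; simp) w inferInstance (by
        intro δ hδ
        rw [Finset.sum_image (fun _ _ _ _ h => he h)]
        have h1 : f (v δ) = 0 := hf (Submodule.subset_span ⟨δ, hδ, rfl⟩)
        rw [hfe] at h1
        rw [← h1]
        refine Finset.sum_congr rfl fun j _ => ?_
        rw [hw, mul_comm])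
    apply LinearMap.ext
    intro x
    rw [hfe]
    simp only [LinearMap.zero_apply]
    refine Finset.sum_eq_zero fun j _ => ?_
    rw [← hw, this (e j) (Finset.mem_image_of_mem _ (Finset.mem_univ _)), mul_zero]
  obtain ⟨b, hbS, hspan, hli⟩ := exists_linearIndependent K S
  rw [hS] at hspan
  let B := Module.Basis.mk hli (by rw [Subtype.range_coe]; exact hspan.ge)
  have : Fintype b := FiniteDimensional.fintypeBasisIndex B
  have hcard : Fintype.card (Fin k) = Fintype.card b := by
    rw [← Module.finrank_eq_card_basis B]; simp
  let E : Fin k ≃ b := Fintype.equivOfCardEq hcard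
  have hch : ∀ i : Fin k, ∃ δ : Fin n →₀ ℕ, (∑ j, δ j) + 1 ≤ k ∧ v δ = (E i : Fin k → K) := by
    intro i
    obtain ⟨δ, h1, h2⟩ := hbS (E i).2
    exact ⟨δ, h1, h2⟩
  choose δ hδ1 hδ2 using hch
  refine ⟨δ, hδ1, ?_⟩
  have hli2 : LinearIndependent K (Matrix.of fun i j => (bin (δ i) (e j) : K)).row := by
    have : (Matrix.of fun i j => (bin (δ i) (e j) : K)).row = (fun x : b => (x : Fin k → K)) ∘ E := by
      funext i
      exact hδ2 i
    rw [this]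
    exact hli.comp _ E.injective
  rw [Matrix.linearIndependent_rows_iff_isUnit] at hli2
  exact ((Matrix.isUnit_iff_isUnit_det _).mp hli2).ne_zero

lemma coeff_prod_of_le {n : ℕ} {R ι : Type*} [CommRing R] (m : MonomialOrder (Fin n))
    (P : ι → MvPolynomial (Fin n) R) (a : ι → (Fin n →₀ ℕ)) (s : Finset ι)
    (h : ∀ i ∈ s, m.toSyn (m.degree (P i)) ≤ m.toSyn (a i)) :
    coeff (∑ i ∈ s, a i) (∏ i ∈ s, P i) = ∏ i ∈ s, coeff (a i) (P i) ∧
      m.toSyn (m.degree (∏ i ∈ s, P i)) ≤ m.toSyn (∑ i ∈ s, a i) := by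
  classical
  induction s using Finset.induction_on with
  | empty => simp
  | insert x s hx ih =>
    obtain ⟨h1, h2⟩ := ih fun i hi => h i (Finset.mem_insert_of_mem hi)
    have hx' := h x (Finset.mem_insert_self _ _)
    rw [Finset.prod_insert hx, Finset.sum_insert hx, Finset.prod_insert hx]
    refine ⟨by rw [m.coeff_mul_of_add_of_degree_le hx' h2, h1], ?_⟩
    refine m.degree_mul_le.trans ?_
    rw [map_add, map_add]
    exact add_le_add hx' h2

/-- Generalised Wronskian lemma. -/
theorem wronskian {n k : ℕ} {K : Type*} [Field K] [CharZero K]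
    (φ : Fin k → MvPolynomial (Fin n) K) (hφ : LinearIndependent K φ) :
    ∃ δ : Fin k → (Fin n →₀ ℕ), (∀ i, (∑ j, δ i j) + 1 ≤ k) ∧
      (Matrix.of fun i j => Top (δ i) (φ j)).det ≠ 0 := by
  classical
  let m : MonomialOrder (Fin n) := MonomialOrder.lex
  let ψ : Matrix (Fin k) (Fin k) K → Fin k → MvPolynomial (Fin n) K :=
    fun M j => ∑ l, M l j • φ l
  let 𝒯 : Set (Matrix (Fin k) (Fin k) K) := {M | M.det ≠ 0}
  let μ : Matrix (Fin k) (Fin k) K → m.syn := fun M => ∑ j, m.toSyn (m.degree (ψ M j))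
  have hne : (Set.image μ 𝒯).Nonempty := ⟨μ 1, 1, by simp [𝒯], rfl⟩
  obtain ⟨M, hM, hμ⟩ := WellFounded.min_mem (wellFounded_lt : WellFounded (α := m.syn) (· < ·)) _ hne
  have hmin : ∀ M' ∈ 𝒯, ¬ μ M' < μ M := by
    intro M' hM' hlt
    rw [hμ] at hlt
    exact WellFounded.not_lt_min (wellFounded_lt : WellFounded (α := m.syn) (· < ·)) (Set.image μ 𝒯) (x := μ M') ⟨M', hM', rfl⟩ hlt
  have hψ0 : ∀ M' ∈ 𝒯, ∀ j, ψ M' j ≠ 0 := by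
    intro M' hM' j h0
    have := Fintype.linearIndependent_iff.mp hφ (fun l => M' l j) h0
    exact hM' (Matrix.det_eq_zero_of_column_eq_zero j this)
  have hinj : Function.Injective fun j => m.degree (ψ M j) := by
    intro a b hab
    by_contra hne
    simp only at hab
    set c : K := - (m.leadingCoeff (ψ M b) / m.leadingCoeff (ψ M a)) with hc
    let M' := M.updateCol b (fun l => M l b + c • M l a)
    have hM' : M' ∈ 𝒯 := by
      change M'.det ≠ 0
      rw [Matrix.det_updateCol_add_smul_self M (Ne.symm hne)]
      exact hM
    have e1 : ψ M' b = ψ M b + c • ψ M a := by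
      simp only [ψ, M', Matrix.updateCol_self, add_smul, Finset.sum_add_distrib, Finset.smul_sum,
        smul_smul, smul_eq_mul]
    have e2 : ∀ j, j ≠ b → ψ M' j = ψ M j := by
      intro j hj
      simp only [ψ, M', Matrix.updateCol_ne hj]
    have hle : m.toSyn (m.degree (ψ M' b)) ≤ m.toSyn (m.degree (ψ M b)) := by
      rw [e1]
      refine m.degree_add_le.trans (sup_le le_rfl ?_)
      exact m.degree_smul_le.trans (by rw [hab])
    have hlt : m.toSyn (m.degree (ψ M' b)) < m.toSyn (m.degree (ψ M b)) := by
      refine lt_of_le_of_ne hle fun heq => ?_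
      have heq := m.toSyn.injective heq
      have : coeff (m.degree (ψ M' b)) (ψ M' b) ≠ 0 :=
        m.coeff_degree_ne_zero_iff.mpr (hψ0 M' hM' b)
      apply this
      rw [heq, e1, coeff_add, coeff_smul]
      have h1 : coeff (m.degree (ψ M b)) (ψ M a) = m.leadingCoeff (ψ M a) := by rw [← hab]; rfl
      have h2 : coeff (m.degree (ψ M b)) (ψ M b) = m.leadingCoeff (ψ M b) := rfl
      have h3 : m.leadingCoeff (ψ M a) ≠ 0 := m.leadingCoeff_ne_zero_iff.mpr (hψ0 M hM a)
      rw [h1, h2, hc, smul_eq_mul, neg_mul, div_mul_cancel₀ _ h3, add_neg_cancel]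
    apply hmin M' hM'
    change ∑ j, m.toSyn (m.degree (ψ M' j)) < ∑ j, m.toSyn (m.degree (ψ M j))
    refine Finset.sum_lt_sum (fun j _ => ?_) ⟨b, Finset.mem_univ _, hlt⟩
    by_cases hj : j = b
    · rw [hj]; exact hle
    · rw [e2 j hj]
  obtain ⟨δ, hδ1, hδ2⟩ := exists_bin_det (K := K) _ hinj
  refine ⟨δ, hδ1, fun h0 => hδ2 ?_⟩
  have hprod : (Matrix.of fun i j => Top (δ i) (ψ M j))
      = (Matrix.of fun i j => Top (δ i) (φ j)) * (M.map C) := by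
    ext1 i j
    simp only [Matrix.of_apply, Matrix.mul_apply, Matrix.map_apply, ψ, Top_sum_smul]
    refine Finset.sum_congr rfl fun l _ => ?_
    rw [smul_eq_C_mul, mul_comm]
  have h1 : (Matrix.of fun i j => Top (δ i) (ψ M j)).det = 0 := by
    rw [hprod, Matrix.det_mul, h0, zero_mul]
  have h2 := congrArg (coeff (∑ j, m.degree (ψ M j))) h1
  rw [Matrix.det_apply, coeff_sum, coeff_zero] at h2
  have h3 : ∀ σ : Equiv.Perm (Fin k), coeff (∑ j, m.degree (ψ M j))
      (Equiv.Perm.sign σ • ∏ i, (Matrix.of fun i j => Top (δ i) (ψ M j)) (σ i) i)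
      = (Equiv.Perm.sign σ • ∏ i, (Matrix.of fun i j => (bin (δ i) (m.degree (ψ M j)) : K)) (σ i) i)
        * ∏ j, m.leadingCoeff (ψ M j) := by
    intro σ
    have := (coeff_prod_of_le m (fun i => Top (δ (σ i)) (ψ M i)) (fun i => m.degree (ψ M i))
      Finset.univ (by
        intro i _
        rw [m.degree_le_iff]
        intro d hd
        apply m.le_degree
        rw [mem_support_iff] at hd ⊢
        intro h
        apply hd
        rw [coeff_Top, h, mul_zero])).1
    simp only [Matrix.of_apply]
    have hs : ∀ (u : ℤˣ) (p : MvPolynomial (Fin n) K) (d), coeff d (u • p) = u • coeff d p := by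
      intro u p d
      rcases Int.units_eq_one_or u with rfl | rfl <;> simp
    rw [hs, this]
    simp only [coeff_Top]
    rw [Finset.prod_mul_distrib, smul_mul_assoc]
    rfl
  rw [Finset.sum_congr rfl fun σ _ => h3 σ, ← Finset.sum_mul, ← Matrix.det_apply] at h2
  rcases mul_eq_zero.mp h2 with h | h
  · exact h
  · exfalso
    rw [Finset.prod_eq_zero_iff] at h
    obtain ⟨j, _, hj⟩ := h
    exact m.leadingCoeff_ne_zero_iff.mpr (hψ0 M hM j) hj

end RothAux

namespace RothAux
open MvPolynomial

/-- Taylor shift. -/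
noncomputable def shift {n : ℕ} {R : Type*} [CommRing R] (γ : Fin n → R) :
    MvPolynomial (Fin n) R →ₐ[R] MvPolynomial (Fin n) R :=
  aeval (fun j => X j + C (γ j))

/-- weight of an exponent -/
noncomputable def wt {n : ℕ} (w : Fin n → ℝ) (e : Fin n →₀ ℕ) : ℝ := ∑ j, w j * (e j : ℝ)

/-- all exponents have weight at least `θ` -/
def IdxGE {n : ℕ} {R : Type*} [CommRing R] (w : Fin n → ℝ) (θ : ℝ)
    (g : MvPolynomial (Fin n) R) : Prop := ∀ e, coeff e g ≠ 0 → θ ≤ wt w e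

lemma wt_add {n : ℕ} (w : Fin n → ℝ) (e f : Fin n →₀ ℕ) : wt w (e + f) = wt w e + wt w f := by
  simp [wt, mul_add, Finset.sum_add_distrib]

lemma wt_single {n : ℕ} (w : Fin n → ℝ) (j : Fin n) : wt w (Finsupp.single j 1) = w j := by
  classical
  unfold wt
  rw [Finset.sum_eq_single j]
  · simp
  · intro b _ hb; simp [Finsupp.single_apply, hb.symm]
  · simp

lemma wt_nonneg {n : ℕ} {w : Fin n → ℝ} (hw : ∀ j, 0 ≤ w j) (e : Fin n →₀ ℕ) : 0 ≤ wt w e :=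
  Finset.sum_nonneg fun j _ => mul_nonneg (hw j) (Nat.cast_nonneg _)

section idx
variable {n : ℕ} {R : Type*} [CommRing R] {w : Fin n → ℝ}

lemma IdxGE.mono {θ θ' : ℝ} {g : MvPolynomial (Fin n) R} (h : IdxGE w θ g) (hle : θ' ≤ θ) :
    IdxGE w θ' g := fun e he => hle.trans (h e he)

lemma idx_nonneg (hw : ∀ j, 0 ≤ w j) (g : MvPolynomial (Fin n) R) : IdxGE w 0 g :=
  fun e _ => wt_nonneg hw e

lemma IdxGE.sum {ι : Type*} {θ : ℝ} {s : Finset ι} {g : ι → MvPolynomial (Fin n) R}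
    (h : ∀ i ∈ s, IdxGE w θ (g i)) : IdxGE w θ (∑ i ∈ s, g i) := by
  intro e he
  rw [coeff_sum] at he
  obtain ⟨i, hi, hne⟩ := Finset.exists_ne_zero_of_sum_ne_zero he
  exact h i hi e hne

lemma IdxGE.mul {θ θ' : ℝ} {f g : MvPolynomial (Fin n) R} (hf : IdxGE w θ f) (hg : IdxGE w θ' g) :
    IdxGE w (θ + θ') (f * g) := by
  classical
  intro e he
  rw [coeff_mul] at he
  obtain ⟨⟨a, b⟩, hi, hne⟩ := Finset.exists_ne_zero_of_sum_ne_zero he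
  rw [Finset.HasAntidiagonal.mem_antidiagonal] at hi
  simp only at hi hne
  rw [← hi, wt_add]
  exact add_le_add (hf a (left_ne_zero_of_mul hne)) (hg b (right_ne_zero_of_mul hne))

lemma IdxGE.sub {θ : ℝ} {f g : MvPolynomial (Fin n) R} (hf : IdxGE w θ f) (hg : IdxGE w θ g) :
    IdxGE w θ (f - g) := by
  intro e he
  rw [coeff_sub] at he
  by_cases h : coeff e f = 0
  · apply hg e; intro h'; rw [h, h', sub_zero] at he; exact he rfl
  · exact hf e h

lemma IdxGE.prod {ι : Type*} {θ : ι → ℝ} {s : Finset ι} {g : ι → MvPolynomial (Fin n) R}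
    (h : ∀ i ∈ s, IdxGE w (θ i) (g i)) : IdxGE w (∑ i ∈ s, θ i) (∏ i ∈ s, g i) := by
  classical
  induction s using Finset.induction_on with
  | empty =>
    intro e he
    simp only [Finset.prod_empty, coeff_one] at he
    have : 0 = e := by by_contra hc; simp [hc] at he
    simp [← this, wt]
  | insert a s ha ih =>
    rw [Finset.sum_insert ha, Finset.prod_insert ha]
    exact (h a (Finset.mem_insert_self _ _)).mul (ih fun i hi => h i (Finset.mem_insert_of_mem hi))

lemma coeff_units_smul (u : ℤˣ) (p : MvPolynomial (Fin n) R) (d : Fin n →₀ ℕ) :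
    coeff d (u • p) = u • coeff d p := by
  rcases Int.units_eq_one_or u with rfl | rfl <;> simp

lemma IdxGE.det {k : ℕ} {θ : Fin k → ℝ} {M : Matrix (Fin k) (Fin k) (MvPolynomial (Fin n) R)}
    (h : ∀ i l, IdxGE w (θ l) (M i l)) : IdxGE w (∑ l, θ l) M.det := by
  rw [Matrix.det_apply]
  refine IdxGE.sum fun σ _ => ?_
  have := IdxGE.prod (s := Finset.univ) (g := fun l => M (σ l) l) (fun l _ => h (σ l) l)
  intro e he
  apply this e
  intro h0
  rw [coeff_units_smul, h0, smul_zero] at he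
  exact he rfl

lemma IdxGE.pderiv {θ : ℝ} {g : MvPolynomial (Fin n) R} (h : IdxGE w θ g) (j : Fin n) :
    IdxGE w (θ - w j) (pderiv j g) := by
  intro e he
  rw [coeff_pderiv] at he
  have := h _ (left_ne_zero_of_mul he)
  rw [wt_add, wt_single] at this
  linarith

lemma shift_pderiv (γ : Fin n → R) (j : Fin n) (f : MvPolynomial (Fin n) R) :
    shift γ (MvPolynomial.pderiv j f) = MvPolynomial.pderiv j (shift γ f) := by
  classical
  induction f using MvPolynomial.induction_on with
  | C a => simp [shift]
  | add p q hp hq => simp only [map_add, hp, hq]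
  | mul_X p i hp =>
    have hX : shift γ (X i) = X i + C (γ i) := by simp [shift]
    have hs : MvPolynomial.pderiv j (X i + C (γ i)) = MvPolynomial.pderiv j (X i : MvPolynomial (Fin n) R) := by
      rw [map_add, pderiv_C, add_zero]
    have hs2 : shift γ (MvPolynomial.pderiv j (X i : MvPolynomial (Fin n) R))
        = MvPolynomial.pderiv j (X i : MvPolynomial (Fin n) R) := by
      rw [pderiv_X]
      by_cases h : i = j
      · subst h; simp
      · simp [Pi.single_apply, h]
    rw [map_mul (shift γ), pderiv_mul, pderiv_mul, map_add, map_mul (shift γ), map_mul (shift γ), hp,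
      hs2, hX, hs]

lemma coeff_X_mul_pderiv (j : Fin n) (f : MvPolynomial (Fin n) R) (e : Fin n →₀ ℕ) :
    coeff e (X j * MvPolynomial.pderiv j f) = (e j : R) * coeff e f := by
  classical
  induction f using MvPolynomial.induction_on' with
  | add p q hp hq => simp only [map_add, mul_add, coeff_add, hp, hq]
  | monomial d r =>
    rw [X_mul_pderiv_monomial, coeff_smul, coeff_monomial]
    split_ifs with h
    · rw [h]; simp
    · simp

lemma Top_zero (f : MvPolynomial (Fin n) R) : Top 0 f = f := by
  ext e; simp [coeff_Top, bin]

lemma Top_succ (δ : Fin n →₀ ℕ) (l : Fin n) (f : MvPolynomial (Fin n) R) :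
    C ((δ l + 1 : ℕ) : R) * Top (δ + Finsupp.single l 1) f
      = X l * MvPolynomial.pderiv l (Top δ f) - C ((δ l : ℕ) : R) * Top δ f := by
  ext e
  rw [coeff_sub, coeff_X_mul_pderiv, coeff_C_mul, coeff_C_mul, coeff_Top, coeff_Top]
  have hb : (((δ l + 1) * bin (δ + Finsupp.single l 1) e + δ l * bin δ e : ℕ) : R)
              = ((e l * bin δ e : ℕ) : R) := by rw [bin_succ]
  push_cast at hb ⊢
  linear_combination (coeff e f) * hb

end idx

lemma IdxGE.top {n : ℕ} {K : Type*} [Field K] [CharZero K] {w : Fin n → ℝ} (hw : ∀ j, 0 ≤ w j)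
    {θ : ℝ} {γ : Fin n → K} {f : MvPolynomial (Fin n) K} (h : IdxGE w θ (shift γ f)) :
    ∀ (N : ℕ) (δ : Fin n →₀ ℕ), ∑ j, δ j = N → IdxGE w (θ - wt w δ) (shift γ (Top δ f)) := by
  intro N
  induction N with
  | zero =>
    intro δ hδ
    have : δ = 0 := by
      ext j; simpa using (Finset.sum_eq_zero_iff.mp hδ) j (Finset.mem_univ _)
    rw [this, Top_zero]
    simpa [wt] using h
  | succ N ih =>
    intro δ hδ
    obtain ⟨l, hl⟩ : ∃ l, δ l ≠ 0 := by
      by_contra! hc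
      simp [hc] at hδ
    set d := δ - Finsupp.single l 1 with hd
    have hδd : δ = d + Finsupp.single l 1 := (Finsupp.sub_add_single_one_cancel hl).symm
    have hs : ∑ j, d j = N := by
      have h1 : ∑ j, (Finsupp.single l 1 : Fin n →₀ ℕ) j = 1 := by
        simp [Finsupp.single_apply]
      rw [hδd] at hδ
      simp only [Finsupp.add_apply, Finset.sum_add_distrib] at hδ
      omega
    have ihd := ih d hs
    rw [hδd, wt_add, wt_single]
    have key : IdxGE w (θ - (wt w d + w l))
        (shift γ (X l * MvPolynomial.pderiv l (Top d f) - C ((d l : ℕ) : K) * Top d f)) := by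
      rw [map_sub, map_mul, map_mul, shift_pderiv]
      apply IdxGE.sub
      · have := (idx_nonneg hw (shift γ (X l))).mul (ihd.pderiv l)
        exact this.mono (by linarith)
      · have := (idx_nonneg hw (shift γ (C ((d l : ℕ) : K)))).mul ihd
        exact this.mono (by linarith [hw l])
    rw [← Top_succ, map_mul] at key
    intro e he
    apply key e
    have hC : shift γ (C ((d l + 1 : ℕ) : K)) = C ((d l + 1 : ℕ) : K) := by simp [shift]
    rw [hC, coeff_C_mul]
    exact mul_ne_zero (Nat.cast_ne_zero.mpr (Nat.succ_ne_zero _)) he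


/-- sum of absolute values of coefficients -/
noncomputable def L1 {n : ℕ} (f : MvPolynomial (Fin n) ℤ) : ℝ := ∑ e ∈ f.support, |((coeff e f : ℤ) : ℝ)|

lemma L1_eq {n : ℕ} (f : MvPolynomial (Fin n) ℤ) (s : Finset (Fin n →₀ ℕ)) (h : f.support ⊆ s) :
    L1 f = ∑ e ∈ s, |((coeff e f : ℤ) : ℝ)| := by
  refine Finset.sum_subset h fun e _ he => ?_
  rw [notMem_support_iff.mp he]; simp

lemma L1_nonneg {n : ℕ} (f : MvPolynomial (Fin n) ℤ) : 0 ≤ L1 f :=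
  Finset.sum_nonneg fun _ _ => abs_nonneg _

lemma coeff_le_L1 {n : ℕ} (f : MvPolynomial (Fin n) ℤ) (e : Fin n →₀ ℕ) :
    |((coeff e f : ℤ) : ℝ)| ≤ L1 f := by
  by_cases h : e ∈ f.support
  · exact Finset.single_le_sum (f := fun e => |((coeff e f : ℤ) : ℝ)|) (fun _ _ => abs_nonneg _) h
  · rw [notMem_support_iff.mp h]; simpa using L1_nonneg f

lemma L1_zero {n : ℕ} : L1 (0 : MvPolynomial (Fin n) ℤ) = 0 := by simp [L1]

lemma L1_add {n : ℕ} (f g : MvPolynomial (Fin n) ℤ) : L1 (f + g) ≤ L1 f + L1 g := by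
  classical
  rw [L1_eq (f + g) (f.support ∪ g.support) support_add,
    L1_eq f (f.support ∪ g.support) Finset.subset_union_left,
    L1_eq g (f.support ∪ g.support) Finset.subset_union_right, ← Finset.sum_add_distrib]
  refine Finset.sum_le_sum fun e _ => ?_
  rw [coeff_add]; push_cast; exact abs_add_le _ _

lemma L1_sum {n : ℕ} {ι : Type*} (s : Finset ι) (f : ι → MvPolynomial (Fin n) ℤ) :
    L1 (∑ i ∈ s, f i) ≤ ∑ i ∈ s, L1 (f i) := by
  classical
  induction s using Finset.induction_on with
  | empty => simp [L1_zero]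
  | insert a s ha ih =>
    rw [Finset.sum_insert ha, Finset.sum_insert ha]
    exact (L1_add _ _).trans (by linarith)

lemma L1_monomial {n : ℕ} (e : Fin n →₀ ℕ) (c : ℤ) : L1 (monomial e c) ≤ |(c : ℝ)| := by
  classical
  rw [L1_eq _ {e} support_monomial_subset]; simp

lemma L1_mul {n : ℕ} (f g : MvPolynomial (Fin n) ℤ) : L1 (f * g) ≤ L1 f * L1 g := by
  have h : f * g = ∑ a ∈ f.support, ∑ b ∈ g.support, monomial (a + b) (coeff a f * coeff b g) := by
    conv_lhs => rw [← f.support_sum_monomial_coeff, ← g.support_sum_monomial_coeff]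
    rw [Finset.sum_mul_sum]
    simp only [monomial_mul]
  have hr : L1 f * L1 g = ∑ a ∈ f.support, ∑ b ∈ g.support,
      |((coeff a f : ℤ) : ℝ)| * |((coeff b g : ℤ) : ℝ)| := by
    rw [L1, L1, Finset.sum_mul_sum]
  rw [h, hr]
  refine (L1_sum _ _).trans (Finset.sum_le_sum fun a _ => (L1_sum _ _).trans
    (Finset.sum_le_sum fun b _ => (L1_monomial _ _).trans ?_))
  push_cast; rw [abs_mul]

lemma L1_prod {n : ℕ} {ι : Type*} (s : Finset ι) (f : ι → MvPolynomial (Fin n) ℤ) (B : ℝ)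
    (h : ∀ i ∈ s, L1 (f i) ≤ B) : L1 (∏ i ∈ s, f i) ≤ B ^ s.card := by
  classical
  induction s using Finset.induction_on with
  | empty => simpa using L1_monomial (n := n) 0 1
  | insert a s ha ih =>
    rw [Finset.prod_insert ha, Finset.card_insert_of_notMem ha, pow_succ']
    have h1 := h a (Finset.mem_insert_self _ _)
    exact (L1_mul _ _).trans (mul_le_mul h1 (ih fun i hi => h i (Finset.mem_insert_of_mem hi))
      (L1_nonneg _) ((L1_nonneg _).trans h1))

lemma L1_det {n k : ℕ} (M : Matrix (Fin k) (Fin k) (MvPolynomial (Fin n) ℤ)) (B : ℝ)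
    (h : ∀ i l, L1 (M i l) ≤ B) : L1 M.det ≤ k.factorial * B ^ k := by
  rw [Matrix.det_apply]
  refine (L1_sum _ _).trans ?_
  have : ∀ σ ∈ (Finset.univ : Finset (Equiv.Perm (Fin k))),
      L1 (Equiv.Perm.sign σ • ∏ i, M (σ i) i) ≤ B ^ k := by
    intro σ _
    have h1 := L1_prod Finset.univ (fun i => M (σ i) i) B (fun i _ => h _ _)
    rw [Finset.card_univ, Fintype.card_fin] at h1
    rcases Int.units_eq_one_or (Equiv.Perm.sign σ) with hs | hs <;> rw [hs]
    · simpa using h1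
    · refine le_trans (le_of_eq ?_) h1
      simp [L1]
  refine (Finset.sum_le_sum this).trans ?_
  simp [Fintype.card_perm]

/-- degree bound in each variable -/
def DegLE {n : ℕ} {R : Type*} [CommRing R] (r : Fin n → ℕ) (f : MvPolynomial (Fin n) R) : Prop :=
  ∀ e, coeff e f ≠ 0 → ∀ j, e j ≤ r j

lemma DegLE.prod {n : ℕ} {R ι : Type*} [CommRing R] {r : Fin n → ℕ} {s : Finset ι}
    {f : ι → MvPolynomial (Fin n) R} (h : ∀ i ∈ s, DegLE r (f i)) :
    DegLE (fun j => s.card * r j) (∏ i ∈ s, f i) := by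
  classical
  induction s using Finset.induction_on with
  | empty =>
    intro e he
    simp only [Finset.prod_empty, coeff_one] at he
    have : 0 = e := by by_contra hc; simp [hc] at he
    simp [← this]
  | insert a s ha ih =>
    intro e he j
    rw [Finset.prod_insert ha, coeff_mul] at he
    obtain ⟨⟨x, y⟩, hi, hne⟩ := Finset.exists_ne_zero_of_sum_ne_zero he
    rw [Finset.HasAntidiagonal.mem_antidiagonal] at hi
    simp only at hi hne
    have h1 := h a (Finset.mem_insert_self _ _) x (left_ne_zero_of_mul hne) j
    have h2 := ih (fun i hi => h i (Finset.mem_insert_of_mem hi)) y (right_ne_zero_of_mul hne) j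
    rw [Finset.card_insert_of_notMem ha, ← hi, Finsupp.add_apply]
    simp only at h2 ⊢
    rw [add_mul]
    omega

lemma DegLE.det {n k : ℕ} {R : Type*} [CommRing R] {r : Fin n → ℕ}
    {M : Matrix (Fin k) (Fin k) (MvPolynomial (Fin n) R)} (h : ∀ i l, DegLE r (M i l)) :
    DegLE (fun j => k * r j) M.det := by
  intro e he
  rw [Matrix.det_apply, coeff_sum] at he
  obtain ⟨σ, _, hne⟩ := Finset.exists_ne_zero_of_sum_ne_zero he
  have := DegLE.prod (s := Finset.univ) (f := fun l => M (σ l) l) (fun l _ => h (σ l) l) e (by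
    intro h0; rw [coeff_units_smul, h0, smul_zero] at hne; exact hne rfl)
  simpa using this

lemma DegLE.top {n : ℕ} {R : Type*} [CommRing R] {r : Fin n → ℕ} {f : MvPolynomial (Fin n) R}
    (h : DegLE r f) (δ : Fin n →₀ ℕ) : DegLE r (Top δ f) := by
  intro e he
  rw [coeff_Top] at he
  exact h e (right_ne_zero_of_mul he)

lemma bin_le {n : ℕ} (δ e : Fin n →₀ ℕ) : bin δ e ≤ 2 ^ (∑ j, e j) := by
  unfold bin
  rw [← Finset.prod_pow_eq_pow_sum]
  exact Finset.prod_le_prod' fun j _ => Nat.choose_le_two_pow _ _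

lemma L1_Top {n : ℕ} {r : Fin n → ℕ} {f : MvPolynomial (Fin n) ℤ}
    (h : DegLE r f) (δ : Fin n →₀ ℕ) : L1 (Top δ f) ≤ 2 ^ (∑ j, r j) * L1 f := by
  have hs : (Top δ f).support ⊆ f.support := by
    intro e he
    rw [mem_support_iff, coeff_Top] at he
    exact mem_support_iff.mpr (right_ne_zero_of_mul he)
  rw [L1_eq _ _ hs, L1, Finset.mul_sum]
  refine Finset.sum_le_sum fun e he => ?_
  rw [coeff_Top]
  push_cast
  rw [abs_mul]
  refine mul_le_mul_of_nonneg_right ?_ (abs_nonneg _)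
  rw [Nat.abs_cast]
  have h1 : bin δ e ≤ 2 ^ (∑ j, r j) := (bin_le δ e).trans
    (Nat.pow_le_pow_right (by norm_num) (Finset.sum_le_sum fun j _ => h e (mem_support_iff.mp he) j))
  exact_mod_cast h1


lemma one_var (V : Polynomial ℤ) (hV : V ≠ 0) (p : ℤ) (q : ℕ) (hq : 0 < q)
    (hpq : IsCoprime p (q : ℤ)) (B : ℝ) (hB : ∀ l, |(V.coeff l : ℝ)| ≤ B) :
    ∃ l, (Polynomial.taylor ((p : ℚ) / q) (V.map (Int.castRingHom ℚ))).coeff l ≠ 0 ∧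
      ((q : ℝ) ^ l ≤ B) := by
  classical
  set F := Polynomial.taylor ((p : ℚ) / q) (V.map (Int.castRingHom ℚ)) with hF
  have hq' : (q : ℚ) ≠ 0 := by exact_mod_cast hq.ne'
  have hF0 : F ≠ 0 := by
    rw [hF, Ne, Polynomial.taylor_eq_zero]
    rwa [Polynomial.map_eq_zero_iff (RingHom.injective_int _)]
  have hex : ∃ l, F.coeff l ≠ 0 := by
    by_contra! hc
    exact hF0 (Polynomial.ext (by simpa using hc))
  set l := Nat.find hex with hl
  refine ⟨l, Nat.find_spec hex, ?_⟩
  have hdvd : Polynomial.X ^ l ∣ F := by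
    rw [Polynomial.X_pow_dvd_iff]
    intro d hd
    by_contra hne
    exact Nat.find_min hex hd hne
  let D : Polynomial ℤ := Polynomial.C (q : ℤ) * Polynomial.X - Polynomial.C p
  have hD1 : D.coeff 1 = q := by
    rw [Polynomial.coeff_sub, Polynomial.coeff_C_mul, Polynomial.coeff_X_one, Polynomial.coeff_C,
      if_neg one_ne_zero, mul_one, sub_zero]
  have hD0 : D.coeff 0 = -p := by simp [D]
  have hDprim : D.IsPrimitive := by
    rw [Polynomial.isPrimitive_iff_isUnit_of_C_dvd]
    intro c hc
    rw [Polynomial.C_dvd_iff_dvd_coeff] at hc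
    have h1 := hc 1
    have h0 := hc 0
    rw [hD1] at h1
    rw [hD0, dvd_neg] at h0
    exact hpq.isUnit_of_dvd' h0 h1
  have hprim : (D ^ l).IsPrimitive := by
    clear_value l
    induction l with
    | zero => simpa using Polynomial.isPrimitive_one
    | succ l ih => 
      rw [pow_succ]; exact Polynomial.IsPrimitive.mul (by
        clear * - hDprim
        induction l with
        | zero => simpa using Polynomial.isPrimitive_one
        | succ l ih => rw [pow_succ]; exact Polynomial.IsPrimitive.mul ih hDprim) hDprim
  have hDl : D ^ l ∣ V := by
    rw [Polynomial.IsPrimitive.Int.dvd_iff_map_cast_dvd_map_cast _ _ hprim]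
    obtain ⟨G, hG⟩ := hdvd
    have h2 : V.map (Int.castRingHom ℚ) = Polynomial.taylor (-((p : ℚ) / q)) F := by
      rw [hF, Polynomial.taylor_taylor]; simp
    rw [h2, hG, Polynomial.taylor_mul, Polynomial.taylor_X_pow]
    refine Dvd.dvd.mul_right ?_ _
    rw [Polynomial.map_pow]
    apply pow_dvd_pow_of_dvd
    refine ⟨Polynomial.C ((q : ℚ)⁻¹), ?_⟩
    simp only [D, Polynomial.map_sub, Polynomial.map_mul, Polynomial.map_C, Polynomial.map_X]
    have : (Polynomial.C (q : ℚ)) * Polynomial.C ((q : ℚ)⁻¹) = 1 := by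
      rw [← Polynomial.C_mul, mul_inv_cancel₀ hq', Polynomial.C_1]
    have h3 : Polynomial.C (-((p : ℚ) / q)) = - (Polynomial.C (p : ℚ) * Polynomial.C ((q : ℚ)⁻¹)) := by
      rw [← Polynomial.C_mul, ← Polynomial.C_neg, div_eq_mul_inv]
    rw [h3]
    simp only [eq_intCast, Int.cast_natCast]
    linear_combination (-Polynomial.X) * this
  obtain ⟨G, hG⟩ := hDl
  have hlc : V.leadingCoeff = (q : ℤ) ^ l * G.leadingCoeff := by
    rw [hG, Polynomial.leadingCoeff_mul, Polynomial.leadingCoeff_pow]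
    congr 2
    have : D = Polynomial.C (q : ℤ) * Polynomial.X + Polynomial.C (-p) := by simp [D]; ring
    rw [this, Polynomial.leadingCoeff_linear (by exact_mod_cast hq.ne')]
  have hG0 : G.leadingCoeff ≠ 0 := by
    rw [Ne, Polynomial.leadingCoeff_eq_zero]
    rintro rfl
    exact hV (by rw [hG, mul_zero])
  have h1 : (1 : ℝ) ≤ |(G.leadingCoeff : ℝ)| := by
    exact_mod_cast Int.one_le_abs hG0
  refine le_trans ?_ (hB V.natDegree)
  change (q : ℝ) ^ l ≤ |(V.leadingCoeff : ℝ)|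
  rw [hlc]
  push_cast
  rw [abs_mul, abs_of_nonneg (by positivity : (0 : ℝ) ≤ (q : ℝ) ^ l)]
  nlinarith [show (0 : ℝ) ≤ (q : ℝ) ^ l by positivity]

end RothAux

namespace RothAux
open MvPolynomial

section tens
variable {n : ℕ} {K : Type*} [CommRing K]

/-- product of a polynomial in the last variables and one in the zeroth variable -/
noncomputable def tens (U : MvPolynomial (Fin n) K) (V : Polynomial K) :
    MvPolynomial (Fin (n + 1)) K := rename Fin.succ U * Polynomial.aeval (X 0) V

lemma finSuccEquiv_C' (a : K) : finSuccEquiv K n (C a) = Polynomial.C (C a) := by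
  simp [finSuccEquiv_apply]

lemma finSuccEquiv_rename_succ (U : MvPolynomial (Fin n) K) :
    finSuccEquiv K n (rename Fin.succ U) = Polynomial.C U := by
  induction U using MvPolynomial.induction_on with
  | C a =>
    rw [rename_C, finSuccEquiv_C']
  | add p q hp hq => simp only [map_add, hp, hq]
  | mul_X p i hp => rw [map_mul, map_mul, hp, rename_X, finSuccEquiv_X_succ, ← Polynomial.C_mul]

lemma finSuccEquiv_aeval (V : Polynomial K) :
    finSuccEquiv K n (Polynomial.aeval (X 0) V) = V.map C := by
  induction V using Polynomial.induction_on' with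
  | add p q hp hq => simp only [map_add, hp, hq, Polynomial.map_add]
  | monomial i a =>
    rw [Polynomial.aeval_monomial, map_mul, map_pow, finSuccEquiv_X_zero, Polynomial.map_monomial,
      ← Polynomial.C_mul_X_pow_eq_monomial]
    congr 1
    exact finSuccEquiv_C' a

lemma coeff_tens (U : MvPolynomial (Fin n) K) (V : Polynomial K) (l : ℕ) (e : Fin n →₀ ℕ) :
    coeff (Finsupp.cons l e) (tens U V) = coeff e U * V.coeff l := by
  rw [← finSuccEquiv_coeff_coeff, tens, map_mul, finSuccEquiv_rename_succ, finSuccEquiv_aeval,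
    Polynomial.coeff_C_mul, Polynomial.coeff_map, mul_comm, coeff_C_mul, mul_comm]

lemma ext_cons {f g : MvPolynomial (Fin (n + 1)) K}
    (h : ∀ l e, coeff (Finsupp.cons l e) f = coeff (Finsupp.cons l e) g) : f = g := by
  ext e
  rw [← Finsupp.cons_tail e]; exact h _ _

lemma shift_tens (β : Fin (n + 1) → K) (U : MvPolynomial (Fin n) K) (V : Polynomial K) :
    shift β (tens U V) = tens (shift (fun j => β j.succ) U) (Polynomial.taylor (β 0) V) := by
  rw [tens, tens, map_mul]
  congr 1
  · induction U using MvPolynomial.induction_on with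
    | C a => simp [shift]
    | add p q hp hq => simp only [map_add, hp, hq]
    | mul_X p i hp =>
      rw [map_mul, map_mul, map_mul, map_mul, hp]
      congr 1
      simp [shift]
  · rw [← Polynomial.aeval_algHom_apply, Polynomial.taylor_apply, Polynomial.aeval_comp]
    congr 1
    simp [shift, algebraMap_eq]

/-- one variable version of `Top` -/
noncomputable def Tp (l : ℕ) (V : Polynomial K) : Polynomial K :=
  ∑ i ∈ V.support, Polynomial.monomial i ((i.choose l : K) * V.coeff i)

lemma coeff_Tp (l : ℕ) (V : Polynomial K) (i : ℕ) :
    (Tp l V).coeff i = (i.choose l : K) * V.coeff i := by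
  classical
  rw [Tp, Polynomial.finsetSum_coeff]
  simp only [Polynomial.coeff_monomial]
  rw [Finset.sum_ite_eq' V.support i]
  split_ifs with h
  · rfl
  · rw [Polynomial.notMem_support_iff.mp h, mul_zero]

lemma Top_tens (l : ℕ) (δ : Fin n →₀ ℕ) (U : MvPolynomial (Fin n) K) (V : Polynomial K) :
    Top (Finsupp.cons l δ) (tens U V) = tens (Top δ U) (Tp l V) := by
  apply ext_cons
  intro i e
  rw [coeff_Top, coeff_tens, coeff_tens, coeff_Top, coeff_Tp]
  have : bin (Finsupp.cons l δ) (Finsupp.cons i e) = i.choose l * bin δ e := by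
    simp [bin, Fin.prod_univ_succ]
  rw [this]; push_cast; ring

lemma Top_add (δ : Fin n →₀ ℕ) (f g : MvPolynomial (Fin n) K) :
    Top δ (f + g) = Top δ f + Top δ g := by
  ext e; simp only [coeff_Top, coeff_add]; ring

lemma Top_sum {ι : Type*} (δ : Fin n →₀ ℕ) (s : Finset ι) (f : ι → MvPolynomial (Fin n) K) :
    Top δ (∑ i ∈ s, f i) = ∑ i ∈ s, Top δ (f i) := by
  ext e; simp only [coeff_Top, coeff_sum, Finset.mul_sum]

end tens

lemma reduce_rep {K M N T : Type*} [Field K] [AddCommGroup M] [Module K M] [AddCommGroup N]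
    [Module K N] [AddCommGroup T] [Module K T] (B : M →ₗ[K] N →ₗ[K] T) (t : T) (k : ℕ)
    (φ : Fin k → M) (ψ : Fin k → N) (ht : t = ∑ j, B (φ j) (ψ j)) (h : ¬ LinearIndependent K φ) :
    ∃ k' < k, ∃ (φ' : Fin k' → M) (ψ' : Fin k' → N), t = ∑ j, B (φ' j) (ψ' j) := by
  rw [Fintype.linearIndependent_iff] at h
  push Not at h
  obtain ⟨g, hg, i, hi⟩ := h
  obtain _ | k := k
  · exact i.elim0
  refine ⟨k, Nat.lt_succ_self k, fun j => φ (i.succAbove j),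
    fun j => ψ (i.succAbove j) - ((g i)⁻¹ * g (i.succAbove j)) • ψ i, ?_⟩
  rw [Fin.sum_univ_succAbove _ i] at hg ht
  have h1 : φ i = -∑ j : Fin k, ((g i)⁻¹ * g (i.succAbove j)) • φ (i.succAbove j) := by
    have h2 : g i • φ i = -∑ j : Fin k, g (i.succAbove j) • φ (i.succAbove j) :=
      eq_neg_of_add_eq_zero_left hg
    have h3 : φ i = (g i)⁻¹ • (g i • φ i) := by rw [smul_smul, inv_mul_cancel₀ hi, one_smul]
    rw [h3, h2, smul_neg, Finset.smul_sum]
    simp only [smul_smul]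
  rw [ht]
  simp only [map_sub, Finset.sum_sub_distrib]
  have h4 : B (φ i) (ψ i) = -∑ j : Fin k, B (φ (i.succAbove j))
      (((g i)⁻¹ * g (i.succAbove j)) • ψ i) := by
    rw [h1]
    simp [LinearMap.sum_apply]
  rw [h4]; abel

lemma min_rep {K M N T : Type*} [Field K] [AddCommGroup M] [Module K M] [AddCommGroup N]
    [Module K N] [AddCommGroup T] [Module K T] (B : M →ₗ[K] N →ₗ[K] T) (t : T) (k : ℕ)
    (φ : Fin k → M) (ψ : Fin k → N) (ht : t = ∑ j, B (φ j) (ψ j)) :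
    ∃ k' ≤ k, ∃ (φ' : Fin k' → M) (ψ' : Fin k' → N), t = ∑ j, B (φ' j) (ψ' j) ∧
      LinearIndependent K φ' ∧ LinearIndependent K ψ' := by
  classical
  have hex : ∃ k, ∃ (φ' : Fin k → M) (ψ' : Fin k → N), t = ∑ j, B (φ' j) (ψ' j) := ⟨k, φ, ψ, ht⟩
  obtain ⟨φ', ψ', h⟩ := Nat.find_spec hex
  refine ⟨Nat.find hex, Nat.find_min' hex ⟨φ, ψ, ht⟩, φ', ψ', h, ?_, ?_⟩
  · by_contra hc
    obtain ⟨k', hk', h'⟩ := reduce_rep B t _ φ' ψ' h hc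
    exact Nat.find_min hex hk' h'
  · by_contra hc
    obtain ⟨k', hk', φ'', ψ'', h'⟩ := reduce_rep B.flip t _ ψ' φ' (by simpa using h) hc
    exact Nat.find_min hex hk' ⟨ψ'', φ'', by simpa using h'⟩

lemma wronskian_one {k : ℕ} {K : Type*} [Field K] [CharZero K] (ψ : Fin k → Polynomial K)
    (hψ : LinearIndependent K ψ) : ∃ l : Fin k → ℕ, (∀ i, l i < k) ∧ Function.Injective l ∧
      (Matrix.of fun i j => Tp (l i) (ψ j)).det ≠ 0 := by
  let A : Polynomial K →ₐ[K] MvPolynomial (Fin (0 + 1)) K := Polynomial.aeval (X 0)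
  have hA : ∀ V, A V = tens 1 V := fun V => by simp [A, tens]
  have hAinj : Function.Injective A := by
    intro V V' h
    ext l
    rw [hA, hA] at h
    have := congrArg (coeff (Finsupp.cons l 0)) h
    simpa [coeff_tens] using this
  have hli : LinearIndependent K (fun j => A (ψ j)) :=
    hψ.map' A.toLinearMap (LinearMap.ker_eq_bot.mpr hAinj)
  obtain ⟨δ, hδ, hdet⟩ := wronskian _ hli
  have hT : ∀ i V, Top (δ i) (A V) = A (Tp (δ i 0) V) := by
    intro i V
    have : δ i = Finsupp.cons (δ i 0) 0 := by
      ext j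
      fin_cases j
      simp
    rw [hA, hA]
    conv_lhs => rw [this]
    rw [Top_tens, Subsingleton.elim (0 : Fin 0 →₀ ℕ) 0, Top_zero]
  have hdet2 : A (Matrix.of fun i j => Tp (δ i 0) (ψ j)).det ≠ 0 := by
    rw [AlgHom.map_det]
    convert hdet using 3
    ext i j
    simp [hT]
  have hdet3 : (Matrix.of fun i j => Tp (δ i 0) (ψ j)).det ≠ 0 := by
    intro h; rw [h, map_zero] at hdet2; exact hdet2 rfl
  refine ⟨fun i => δ i 0, fun i => ?_, ?_, hdet3⟩
  · have := hδ i
    simp at this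
    omega
  · intro i i' h
    by_contra hne
    apply hdet3
    exact Matrix.det_zero_of_row_eq hne (by ext1 j; simp only [Matrix.of_apply]; rw [show δ i 0 = δ i' 0 from h])

/-- bilinear version of tens -/
noncomputable def tensB (n : ℕ) : MvPolynomial (Fin n) ℚ →ₗ[ℚ] Polynomial ℚ →ₗ[ℚ]
    MvPolynomial (Fin (n + 1)) ℚ :=
  LinearMap.mk₂ ℚ tens (fun a b c => by simp [tens, add_mul]) (fun a b c => by simp [tens])
    (fun a b c => by simp [tens, mul_add]) (fun a b c => by simp [tens])

lemma tensB_apply (n : ℕ) (U : MvPolynomial (Fin n) ℚ) (V : Polynomial ℚ) :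
    tensB n U V = tens U V := rfl

lemma gen_wronskian {n : ℕ} (P : MvPolynomial (Fin (n + 1)) ℚ) (hP : P ≠ 0) (r0 : ℕ)
    (hdeg : ∀ e, coeff e P ≠ 0 → e 0 ≤ r0) :
    ∃ k, 1 ≤ k ∧ k ≤ r0 + 1 ∧ ∃ (δ : Fin k → Fin n →₀ ℕ) (l : Fin k → ℕ)
      (U : MvPolynomial (Fin n) ℚ) (V : Polynomial ℚ),
      (∀ a, (∑ j, δ a j) + 1 ≤ k) ∧ (∀ b, l b < k) ∧ Function.Injective l ∧ U ≠ 0 ∧ V ≠ 0 ∧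
      (Matrix.of fun a b => Top (Finsupp.cons (l b) (δ a)) P).det = tens U V := by
  have h0 : P = ∑ i : Fin (r0 + 1), tensB n ((finSuccEquiv ℚ n P).coeff i)
      (Polynomial.monomial (i : ℕ) 1) := by
    apply ext_cons
    intro l e
    rw [coeff_sum]
    simp only [tensB_apply, coeff_tens, Polynomial.coeff_monomial,
      finSuccEquiv_coeff_coeff]
    rw [Fin.sum_univ_eq_sum_range (fun i => coeff (Finsupp.cons i e) P * if i = l then 1 else 0)]
    simp only [mul_ite, mul_one, mul_zero]
    rw [Finset.sum_ite_eq' (Finset.range (r0 + 1)) l]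
    split_ifs with h
    · rfl
    · by_contra hne
      have := hdeg _ hne
      rw [Finsupp.cons_zero] at this
      simp at h
      omega
  obtain ⟨k, hk, φ, ψ, hrep, hφ, hψ⟩ := min_rep (tensB n) P _ _ _ h0
  have hk1 : 1 ≤ k := by
    rcases Nat.eq_zero_or_pos k with rfl | h
    · simp at hrep; exact absurd hrep hP
    · exact h
  obtain ⟨δ, hδ, hdU⟩ := wronskian φ hφ
  obtain ⟨l, hl, hinj, hdV⟩ := wronskian_one ψ hψ
  refine ⟨k, hk1, hk, δ, l, _, _, hδ, hl, hinj, hdU, hdV, ?_⟩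
  rw [tens, ← Matrix.det_transpose (Matrix.of fun i j => Tp (l i) (ψ j)), AlgHom.map_det,
    AlgHom.map_det, ← Matrix.det_mul]
  congr 1
  ext1 a b
  rw [Matrix.mul_apply]
  simp only [Matrix.of_apply, AlgHom.mapMatrix_apply, Matrix.map_apply, Matrix.transpose_apply]
  conv_lhs => rw [hrep]
  rw [Top_sum]
  refine Finset.sum_congr rfl fun j _ => ?_
  rw [tensB_apply, Top_tens, tens]

end RothAux

namespace RothAux
open MvPolynomial

lemma slices {n : ℕ} (W : MvPolynomial (Fin (n + 1)) ℤ) (U : MvPolynomial (Fin n) ℚ)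
    (V : Polynomial ℚ) (hU : U ≠ 0) (hV : V ≠ 0)
    (h : map (Int.castRingHom ℚ) W = tens U V) (r : Fin (n + 1) → ℕ) (hr : DegLE r W) :
    ∃ (U' : MvPolynomial (Fin n) ℤ) (V' : Polynomial ℤ) (u v : ℚ), u ≠ 0 ∧ v ≠ 0 ∧
      map (Int.castRingHom ℚ) U' = u • U ∧ V'.map (Int.castRingHom ℚ) = v • V ∧
      L1 U' ≤ L1 W ∧ (∀ l, |(V'.coeff l : ℝ)| ≤ L1 W) ∧ DegLE (fun j => r j.succ) U' := by
  classical
  obtain ⟨e0, he0⟩ := MvPolynomial.ne_zero_iff.mp hU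
  obtain ⟨l0, hl0⟩ : ∃ l, V.coeff l ≠ 0 := by
    by_contra! hc; exact hV (Polynomial.ext (by simpa using hc))
  have hW : ∀ l e, ((coeff (Finsupp.cons l e) W : ℤ) : ℚ) = coeff e U * V.coeff l := by
    intro l e
    rw [← coeff_tens, ← h, coeff_map]; simp
  set F := finSuccEquiv ℤ n W with hF
  let V' : Polynomial ℤ := ∑ l ∈ Finset.range (F.natDegree + 1),
    Polynomial.monomial l (coeff e0 (F.coeff l))
  have hV' : ∀ l, V'.coeff l = coeff (Finsupp.cons l e0) W := by
    intro l
    simp only [V', Polynomial.finsetSum_coeff, Polynomial.coeff_monomial]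
    rw [Finset.sum_ite_eq' _ l, ← finSuccEquiv_coeff_coeff]
    split_ifs with hl
    · rfl
    · rw [← hF, Polynomial.coeff_eq_zero_of_natDegree_lt, coeff_zero]
      simp at hl; omega
  refine ⟨F.coeff l0, V', V.coeff l0, coeff e0 U, hl0, he0, ?_, ?_, ?_, ?_, ?_⟩
  · ext e
    rw [coeff_map, hF, finSuccEquiv_coeff_coeff, coeff_smul, smul_eq_mul, mul_comm, ← hW]; simp
  · ext l
    rw [Polynomial.coeff_map, hV', Polynomial.coeff_smul, smul_eq_mul, ← hW]; simp
  · have h1 : L1 (F.coeff l0) = ∑ e ∈ (F.coeff l0).support.image (Finsupp.cons l0),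
        |((coeff e W : ℤ) : ℝ)| := by
      rw [Finset.sum_image (fun a _ b _ hab => Finsupp.cons_right_injective _ hab), L1]
      refine Finset.sum_congr rfl fun e _ => ?_
      rw [hF, finSuccEquiv_coeff_coeff]
    rw [h1, L1]
    refine Finset.sum_le_sum_of_subset_of_nonneg ?_ (fun _ _ _ => abs_nonneg _)
    intro e he
    obtain ⟨e', he', rfl⟩ := Finset.mem_image.mp he
    rw [mem_support_iff, hF, finSuccEquiv_coeff_coeff] at he'
    exact mem_support_iff.mpr he'
  · intro l; rw [hV']; exact coeff_le_L1 _ _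
  · intro e he j
    rw [hF, finSuccEquiv_coeff_coeff] at he
    have := hr _ he j.succ
    simpa using this

lemma sum_lower (k r0 : ℕ) (hr0 : 0 < r0) (hk : k ≤ r0 + 1) (t : ℝ) (ht : 0 < t) (ht1 : t ≤ 1) :
    (k : ℝ) * t ^ 2 / 4 ≤ ∑ l ∈ Finset.range k, max 0 (t - (l : ℝ) / r0) := by
  have hr : (0 : ℝ) < r0 := by exact_mod_cast hr0
  set m := min k (⌊t * r0⌋₊ + 1) with hm
  have hmk : m ≤ k := min_le_left _ _
  have hmt : m ≤ ⌊t * r0⌋₊ + 1 := min_le_right _ _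
  have h1 : ∑ l ∈ Finset.range m, (t - (l : ℝ) / r0) ≤
      ∑ l ∈ Finset.range k, max 0 (t - (l : ℝ) / r0) := by
    refine (Finset.sum_le_sum fun l _ => le_max_right 0 _).trans ?_
    exact Finset.sum_le_sum_of_subset_of_nonneg (Finset.range_mono hmk)
      (fun _ _ _ => le_max_left _ _)
  have hg : ∀ m : ℕ, ∑ l ∈ Finset.range m, (t - (l : ℝ) / r0) = m * t - m * (m - 1) / (2 * r0) := by
    intro m
    induction m with
    | zero => simp
    | succ m ih => rw [Finset.sum_range_succ, ih]; push_cast; field_simp; ring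
  rw [hg] at h1
  have hfl : (⌊t * r0⌋₊ : ℝ) ≤ t * r0 := Nat.floor_le (by positivity)
  have hm1 : (m : ℝ) - 1 ≤ t * r0 := by
    have : (m : ℝ) ≤ (⌊t * r0⌋₊ : ℝ) + 1 := by exact_mod_cast hmt
    linarith
  have hm2 : (k : ℝ) * t / 2 ≤ m := by
    have hk0 : (0 : ℝ) ≤ k := Nat.cast_nonneg _
    rcases le_total k (⌊t * r0⌋₊ + 1) with h | h
    · rw [hm, min_eq_left h]; nlinarith
    · rw [hm, min_eq_right h]
      have h3 : t * r0 < (⌊t * r0⌋₊ : ℝ) + 1 := Nat.lt_floor_add_one _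
      have h4 : (k : ℝ) ≤ 2 * r0 := by
        have : k ≤ 2 * r0 := by omega
        exact_mod_cast this
      push_cast
      nlinarith
  have hm0 : (0 : ℝ) ≤ m := Nat.cast_nonneg _
  have h5 : (m : ℝ) * (m - 1) / (2 * r0) ≤ m * t / 2 := by
    rw [div_le_div_iff₀ (by positivity) (by norm_num)]
    nlinarith
  nlinarith

lemma factorial_le_exp (k : ℕ) : (k.factorial : ℝ) ≤ exp ((k : ℝ) * k) := by
  have h1 : (k.factorial : ℝ) ≤ (k : ℝ) ^ k := by exact_mod_cast Nat.factorial_le_pow k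
  have h2 : (k : ℝ) ≤ exp k := by linarith [add_one_le_exp (k : ℝ)]
  rw [Real.exp_mul, Real.rpow_natCast]
  exact h1.trans (pow_le_pow_left₀ (Nat.cast_nonneg _) h2 _)

lemma wt_cons {n : ℕ} (w : Fin (n + 1) → ℝ) (l : ℕ) (e : Fin n →₀ ℕ) :
    wt w (Finsupp.cons l e) = w 0 * l + wt (fun j => w j.succ) e := by
  simp [wt, Fin.sum_univ_succ]

theorem roth_lemma (n : ℕ) : ∀ η : ℝ, 0 < η → ∃ ω : ℝ, 0 < ω ∧
    ∀ (r : Fin n → ℕ) (p : Fin n → ℤ) (q : Fin n → ℕ) (Λ : ℝ) (P : MvPolynomial (Fin n) ℤ),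
      (∀ j, 0 < r j) → (∀ i j, i < j → (r i : ℝ) ≤ ω * r j) → (∀ j, 0 < q j) →
      (∀ j, IsCoprime (p j) (q j : ℤ)) → (∀ j, Λ ≤ r j * Real.log (q j)) →
      (∀ j, (r j : ℝ) ≤ ω * Λ) → P ≠ 0 → DegLE r P → L1 P ≤ exp (ω * Λ) →
      ∃ J, coeff J (shift (fun j => (p j : ℚ) / q j) (map (Int.castRingHom ℚ) P)) ≠ 0 ∧
        wt (fun j => 1 / (r j : ℝ)) J ≤ η := by
  induction n with
  | zero =>
    intro η hη
    refine ⟨1, one_pos, fun r p q Λ P _ _ _ _ _ _ hP _ _ => ⟨0, ?_, by simpa [wt] using hη.le⟩⟩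
    obtain ⟨e, he⟩ := MvPolynomial.ne_zero_iff.mp hP
    rw [Subsingleton.elim e 0] at he
    have hC : P = C (coeff 0 P) := by
      ext e'; rw [Subsingleton.elim e' 0, coeff_C, if_pos rfl]
    rw [hC]
    simp only [shift, map_C, aeval_C, algebraMap_eq]
    rw [coeff_C, if_pos rfl, eq_intCast]
    exact_mod_cast he
  | succ n ih =>
    intro η₀ hη₀
    set η := min η₀ 1 with hηdef
    have hη : 0 < η := lt_min hη₀ one_pos
    have hη1 : η ≤ 1 := min_le_right _ _
    obtain ⟨ω', hω', ih'⟩ := ih (η ^ 2 / 64) (by positivity)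
    set ω := min (η / 2) (min ω' (η ^ 2 / 64) / (n + 4)) with hωdef
    have hn4 : (0 : ℝ) < (n : ℝ) + 4 := by positivity
    have hω : 0 < ω := by
      apply lt_min (by positivity)
      exact div_pos (lt_min hω' (by positivity)) hn4
    have hωη : ω ≤ η / 2 := min_le_left _ _
    have hω4 : ω * (n + 4) ≤ min ω' (η ^ 2 / 64) := by
      rw [← le_div_iff₀ hn4]; exact min_le_right _ _
    have hω4a : ω * (n + 4) ≤ ω' := hω4.trans (min_le_left _ _)
    have hω4b : ω * (n + 4) ≤ η ^ 2 / 64 := hω4.trans (min_le_right _ _)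
    have hωω' : ω ≤ ω' := by
      have : (0 : ℝ) ≤ n := Nat.cast_nonneg _
      nlinarith
    refine ⟨ω, hω, ?_⟩
    intro r p q Λ P hr hrr hq hpq hΛ hrΛ hP hdeg hL
    have hr' : ∀ j, (0 : ℝ) < r j := fun j => by exact_mod_cast hr j
    have hr1 : ∀ j, (1 : ℝ) ≤ r j := fun j => by exact_mod_cast hr j
    have hΛ0 : 0 < Λ := by
      have := hrΛ 0
      have h0 := hr' 0
      by_contra hc
      nlinarith
    set PQ := map (Int.castRingHom ℚ) P with hPQ
    have hPQ0 : PQ ≠ 0 := by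
      intro h
      exact hP ((map_injective _ (RingHom.injective_int (Int.castRingHom ℚ))) (by rw [← hPQ, h, map_zero]))
    have hdegQ : ∀ e, coeff e PQ ≠ 0 → e 0 ≤ r 0 := by
      intro e he
      apply hdeg e
      intro h0
      rw [hPQ, coeff_map, h0] at he
      simp at he
    obtain ⟨k, hk1, hk, δ, l, U, V, hδ, hl, hinj, hU, hV, hdet⟩ := gen_wronskian PQ hPQ0 (r 0) hdegQ
    have hkpos : (0 : ℝ) < k := by exact_mod_cast hk1
    set M : Matrix (Fin k) (Fin k) (MvPolynomial (Fin (n + 1)) ℤ) :=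
      Matrix.of fun a b => Top (Finsupp.cons (l b) (δ a)) P with hM
    have hWmap : map (Int.castRingHom ℚ) M.det = tens U V := by
      rw [← hdet, RingHom.map_det]
      congr 1
      ext1 a b
      simp only [hM, RingHom.mapMatrix_apply, Matrix.map_apply, Matrix.of_apply]
      rw [hPQ, Top_map]
    have hWdeg : DegLE (fun j => k * r j) M.det := DegLE.det fun a b => hdeg.top _
    have hWL : L1 M.det ≤ exp (ω * (n + 4) * (k * Λ)) := by
      have h1 := L1_det M (2 ^ (∑ j, r j) * exp (ω * Λ)) (fun a b => (L1_Top hdeg _).trans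
        (mul_le_mul_of_nonneg_left hL (by positivity)))
      refine h1.trans ?_
      have h2 : (2 : ℝ) ^ (∑ j, r j) ≤ exp ((n + 1) * (ω * Λ)) := by
        have h3 : (2 : ℝ) ≤ exp 1 := by linarith [add_one_le_exp (1 : ℝ)]
        refine (pow_le_pow_left₀ (by norm_num) h3 _).trans ?_
        rw [← Real.exp_nat_mul, mul_one]
        apply exp_le_exp.mpr
        push_cast
        refine (Finset.sum_le_sum fun j _ => hrΛ j).trans ?_
        simp
      have h4 : (k : ℝ) ≤ 2 * (ω * Λ) := by
        have h5 : (k : ℝ) ≤ r 0 + 1 := by exact_mod_cast hk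
        linarith [hrΛ 0, hr1 0]
      calc (k.factorial : ℝ) * (2 ^ (∑ j, r j) * exp (ω * Λ)) ^ k
          ≤ exp (k * k) * (exp ((n + 1) * (ω * Λ)) * exp (ω * Λ)) ^ k := by
            gcongr
            exact factorial_le_exp k
        _ = exp (k * k + k * ((n + 1) * (ω * Λ) + ω * Λ)) := by
            rw [← Real.exp_add, ← Real.exp_nat_mul, ← Real.exp_add]
        _ ≤ _ := by
            apply exp_le_exp.mpr
            nlinarith
    obtain ⟨U', V', u, v, hu, hv, hU', hV', hLU, hLV, hdegU⟩ := slices M.det U V hU hV hWmap _ hWdeg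
    have hU'0 : U' ≠ 0 := by
      rintro rfl
      rw [map_zero] at hU'
      exact (smul_ne_zero hu hU) hU'.symm
    have hV'0 : V' ≠ 0 := by
      rintro rfl
      rw [Polynomial.map_zero] at hV'
      exact (smul_ne_zero hv hV) hV'.symm
    obtain ⟨J, hJ, hJw⟩ := ih' (fun j => k * r j.succ) (fun j => p j.succ) (fun j => q j.succ)
      (k * Λ) U' (fun j => Nat.mul_pos hk1 (hr _))
      (fun i j hij => by
        have := hrr i.succ j.succ (Fin.succ_lt_succ_iff.mpr hij)
        have h2 : ω * (r j.succ : ℝ) ≤ ω' * r j.succ := mul_le_mul_of_nonneg_right hωω' (hr' _).le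
        push_cast
        nlinarith)
      (fun j => hq _) (fun j => hpq _)
      (fun j => by push_cast; rw [mul_assoc]; exact mul_le_mul_of_nonneg_left (hΛ _) hkpos.le)
      (fun j => by
        have := hrΛ j.succ
        have h2 : ω * Λ ≤ ω' * Λ := mul_le_mul_of_nonneg_right hωω' hΛ0.le
        push_cast
        nlinarith)
      hU'0 hdegU
      (hLU.trans (hWL.trans (exp_le_exp.mpr (mul_le_mul_of_nonneg_right hω4a (by positivity)))))
    obtain ⟨l0, hl0, hl0q⟩ := one_var V' hV'0 (p 0) (q 0) (hq 0) (hpq 0) _ hLV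
    have hlog : 0 < Real.log (q 0) := by
      by_contra hc
      have := hΛ 0
      nlinarith [hr' 0]
    have hl0r : (l0 : ℝ) / r 0 ≤ k * (η ^ 2 / 64) := by
      have h1 : (l0 : ℝ) * Real.log (q 0) ≤ ω * (n + 4) * (k * Λ) := by
        have h2 := hl0q.trans hWL
        have hq0 : (0 : ℝ) < q 0 := by exact_mod_cast hq 0
        have h3 := Real.log_le_log (by positivity) h2
        rwa [Real.log_pow, Real.log_exp] at h3
      have h4 : (l0 : ℝ) * Real.log (q 0) ≤ (η ^ 2 / 64) * (k * (r 0 * Real.log (q 0))) := by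
        refine h1.trans ?_
        have h5 : (k : ℝ) * Λ ≤ k * (r 0 * Real.log (q 0)) :=
          mul_le_mul_of_nonneg_left (hΛ 0) hkpos.le
        exact mul_le_mul hω4b h5 (by positivity) (by positivity)
      rw [div_le_iff₀ (hr' 0)]
      have h6 : (l0 : ℝ) * Real.log (q 0) ≤ (k * (η ^ 2 / 64) * r 0) * Real.log (q 0) := by linarith
      exact le_of_mul_le_mul_right h6 hlog
    set β : Fin (n + 1) → ℚ := fun j => (p j : ℚ) / q j with hβ
    have hWc : coeff (Finsupp.cons l0 J) (shift β (map (Int.castRingHom ℚ) M.det)) ≠ 0 := by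
      rw [hWmap, shift_tens, coeff_tens]
      apply mul_ne_zero
      · rw [hU', map_smul, coeff_smul, smul_eq_mul] at hJ
        exact right_ne_zero_of_mul hJ
      · rw [hV', map_smul, Polynomial.coeff_smul, smul_eq_mul] at hl0
        exact right_ne_zero_of_mul hl0
    by_contra! hcon
    set w : Fin (n + 1) → ℝ := fun j => 1 / (r j : ℝ) with hw
    have hw0 : ∀ j, 0 ≤ w j := fun j => by simp only [hw]; positivity
    have hidx : IdxGE w η (shift β PQ) := fun e he => (min_le_left _ _).trans (hcon e he).le
    set θ : Fin k → ℝ := fun b => max 0 (η - ω - (l b : ℝ) / r 0) with hθ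
    have hentry : ∀ a b, IdxGE w (θ b) ((Matrix.of fun a b =>
        shift β (Top (Finsupp.cons (l b) (δ a)) PQ)) a b) := by
      intro a b
      simp only [Matrix.of_apply, hθ]
      rcases le_total 0 (η - ω - (l b : ℝ) / r 0) with h | h
      · rw [max_eq_right h]
        refine (IdxGE.top hw0 hidx _ _ rfl).mono ?_
        rw [wt_cons]
        have h1 : wt (fun j => w j.succ) (δ a) ≤ ω := by
          have h2 : ∀ j : Fin n, w j.succ * (δ a j : ℝ) ≤ ω / r 0 * (δ a j : ℝ) := by
            intro j
            refine mul_le_mul_of_nonneg_right ?_ (Nat.cast_nonneg _)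
            simp only [hw]
            rw [div_le_div_iff₀ (hr' _) (hr' _), one_mul]
            exact hrr 0 j.succ (Fin.succ_pos j)
          refine (Finset.sum_le_sum fun j _ => h2 j).trans ?_
          rw [← Finset.mul_sum]
          have h3 : (∑ j, (δ a j : ℝ)) ≤ r 0 := by
            have := hδ a
            have h4 : ∑ j, δ a j ≤ r 0 := by omega
            exact_mod_cast h4
          calc ω / r 0 * ∑ j, (δ a j : ℝ) ≤ ω / r 0 * r 0 := by gcongr
            _ = ω := div_mul_cancel₀ _ (hr' 0).ne'
        have h5 : w 0 * (l b : ℝ) = (l b : ℝ) / r 0 := by simp only [hw]; ring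
        linarith
      · rw [max_eq_left h]; exact idx_nonneg hw0 _
    have hWidx := IdxGE.det hentry
    have hdetS : (Matrix.of fun a b => shift β (Top (Finsupp.cons (l b) (δ a)) PQ)).det
        = shift β (map (Int.castRingHom ℚ) M.det) := by
      rw [hWmap, ← hdet, AlgHom.map_det]
      congr 1
    rw [hdetS] at hWidx
    have hfin := hWidx _ hWc
    have hsum : ∑ b, θ b = ∑ i ∈ Finset.range k, max 0 (η - ω - (i : ℝ) / r 0) := by
      have himg : Finset.univ.image l = Finset.range k := by
        apply Finset.eq_of_subset_of_card_le
        · intro i hi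
          obtain ⟨b, _, rfl⟩ := Finset.mem_image.mp hi
          exact Finset.mem_range.mpr (hl b)
        · rw [Finset.card_image_of_injective _ hinj]; simp
      rw [← himg, Finset.sum_image (fun a _ b _ hab => hinj hab)]
    have hlow := sum_lower k (r 0) (hr 0) hk (η - ω) (by linarith) (by linarith)
    rw [← hsum] at hlow
    have hup : wt w (Finsupp.cons l0 J) ≤ k * (η ^ 2 / 64) + k * (η ^ 2 / 64) := by
      rw [wt_cons]
      have h5 : w 0 * (l0 : ℝ) = (l0 : ℝ) / r 0 := by simp only [hw]; ring
      have h6 : wt (fun j => w j.succ) J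
          = k * wt (fun j => 1 / ((k * r (Fin.succ j) : ℕ) : ℝ)) J := by
        simp only [wt, hw, Finset.mul_sum]
        refine Finset.sum_congr rfl fun j _ => ?_
        have := (hr' j.succ).ne'
        push_cast
        field_simp
      rw [h5, h6]
      exact add_le_add hl0r (mul_le_mul_of_nonneg_left hJw hkpos.le)
    have h7 : (k : ℝ) * (η / 2) ^ 2 / 4 ≤ k * (η - ω) ^ 2 / 4 := by
      have : (η / 2) ^ 2 ≤ (η - ω) ^ 2 := pow_le_pow_left₀ (by positivity) (by linarith) 2
      nlinarith
    nlinarith [mul_pos hkpos (pow_pos hη 2)]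

end RothAux

namespace RothAux
open MvPolynomial

lemma siegel {α β : Type*} [Fintype α] [Fintype β] (A : Matrix α β ℤ) (B : ℝ) (hB : 1 ≤ B)
    (h : ∀ i j, |(A i j : ℝ)| ≤ B) (hcard : 2 * Fintype.card α ≤ Fintype.card β)
    (hpos : 0 < Fintype.card α) :
    ∃ t : β → ℤ, t ≠ 0 ∧ A.mulVec t = 0 ∧ ∀ j, |(t j : ℝ)| ≤ Fintype.card β * B := by
  obtain ⟨t, ht, hAt, hb⟩ := Int.Matrix.exists_ne_zero_int_vec_norm_le A (by omega) hpos
  refine ⟨t, ht, hAt, fun j => ?_⟩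
  have h1 : |(t j : ℝ)| ≤ ‖t‖ := by
    rw [← Int.norm_eq_abs]; exact norm_le_pi_norm t j
  refine h1.trans (hb.trans ?_)
  have hA : max 1 (@norm (Matrix α β ℤ) Matrix.seminormedAddCommGroup.toNorm A) ≤ B := by
    apply max_le hB
    rw [Matrix.norm_le_iff (by linarith)]
    intro i j
    rw [Int.norm_eq_abs]; exact h i j
  have hn : (1 : ℝ) ≤ Fintype.card β := by
    have : 1 ≤ Fintype.card β := by omega
    exact_mod_cast this
  have h2 : (2 : ℝ) * Fintype.card α ≤ Fintype.card β := by exact_mod_cast hcard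
  have h3 : (0 : ℝ) < Fintype.card α := by exact_mod_cast hpos
  have hbase : (1 : ℝ) ≤ Fintype.card β *
      max 1 (@norm (Matrix α β ℤ) Matrix.seminormedAddCommGroup.toNorm A) := by
    have := le_max_left 1 (@norm (Matrix α β ℤ) Matrix.seminormedAddCommGroup.toNorm A)
    nlinarith
  calc _ ≤ (Fintype.card β *
      max 1 (@norm (Matrix α β ℤ) Matrix.seminormedAddCommGroup.toNorm A)) ^ (1 : ℝ) := by
        apply Real.rpow_le_rpow_of_exponent_le hbase
        rw [div_le_one (by linarith)]
        linarith
    _ ≤ _ := by rw [Real.rpow_one]; gcongr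

lemma coeff_shift_monomial {R : Type*} [CommRing R] {n : ℕ} : ∀ (γ : Fin n → R) (e J : Fin n →₀ ℕ) (c : R),
    coeff J (shift γ (monomial e c)) = c * ((bin J e : R) * ∏ j, γ j ^ (e j - J j)) := by
  induction n with
  | zero =>
    intro γ e J c
    rw [Subsingleton.elim e 0, Subsingleton.elim J 0]
    have : (monomial (0 : Fin 0 →₀ ℕ)) c = C c := rfl
    rw [this]
    simp only [shift, aeval_C, algebraMap_eq]
    rw [coeff_C, if_pos rfl]
    simp [bin]
  | succ n ih =>
    intro γ e J c
    have h1 : monomial e c = tens (monomial (Finsupp.tail e) c) (Polynomial.X ^ (e 0)) := by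
      classical
      apply ext_cons
      intro l f
      rw [coeff_tens, coeff_monomial, coeff_monomial, Polynomial.coeff_X_pow]
      have h2 : e = Finsupp.cons l f ↔ (Finsupp.tail e = f ∧ l = e 0) := by
        constructor
        · rintro rfl; simp
        · rintro ⟨rfl, rfl⟩; simp
      rw [if_congr h2 rfl rfl]
      by_cases ha : Finsupp.tail e = f <;> by_cases hb : l = e 0 <;> simp [ha, hb]
    rw [h1, shift_tens, ← Finsupp.cons_tail J, coeff_tens, ih, Polynomial.taylor_X_pow,
      Polynomial.coeff_X_add_C_pow]
    simp only [bin, Fin.prod_univ_succ, Finsupp.cons_zero, Finsupp.cons_succ, Finsupp.tail_apply]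
    push_cast
    ring

lemma coeff_shift {R : Type*} [CommRing R] {n : ℕ} (γ : Fin n → R) (f : MvPolynomial (Fin n) R)
    (J : Fin n →₀ ℕ) : coeff J (shift γ f)
      = ∑ e ∈ f.support, coeff e f * ((bin J e : R) * ∏ j, γ j ^ (e j - J j)) := by
  conv_lhs => rw [← f.support_sum_monomial_coeff, map_sum, coeff_sum]
  exact Finset.sum_congr rfl fun e _ => coeff_shift_monomial _ _ _ _

lemma pow_red (α : ℝ) (G : Polynomial ℤ) (hG : G.Monic) (hd : 0 < G.natDegree)
    (hα : Polynomial.aeval α G = 0) : ∃ A : ℕ, 1 ≤ A ∧ ∀ n : ℕ, ∃ c : Fin G.natDegree → ℤ,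
      α ^ n = ∑ s, (c s : ℝ) * α ^ (s : ℕ) ∧ ∀ s, |c s| ≤ (A : ℤ) ^ n := by
  obtain ⟨d, hdd⟩ : ∃ d, G.natDegree = d + 1 := ⟨G.natDegree - 1, by omega⟩
  rw [hdd]
  have hαd : α ^ (d + 1) = -∑ s : Fin (d + 1), (G.coeff s : ℝ) * α ^ (s : ℕ) := by
    rw [Polynomial.aeval_eq_sum_range, hdd, Finset.sum_range_succ] at hα
    rw [Fin.sum_univ_eq_sum_range (fun s => (G.coeff s : ℝ) * α ^ s) (d + 1)]
    have h1 : G.coeff (d + 1) = 1 := by rw [← hdd]; exact hG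
    simp only [h1, zsmul_eq_mul, Int.cast_one, one_mul] at hα
    linarith
  let S : ℕ := ∑ s : Fin (d + 1), (G.coeff s).natAbs
  have hS : ∀ s : Fin (d + 1), |G.coeff s| ≤ (S : ℤ) := by
    intro s
    rw [Int.abs_eq_natAbs]
    have : (G.coeff s).natAbs ≤ S :=
      Finset.single_le_sum (f := fun s : Fin (d + 1) => (G.coeff s).natAbs) (fun _ _ => Nat.zero_le _)
        (Finset.mem_univ s)
    exact_mod_cast this
  refine ⟨1 + S, by omega, fun n => ?_⟩
  induction n with
  | zero =>
    refine ⟨Fin.cons 1 0, ?_, ?_⟩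
    · simp [Fin.sum_univ_succ]
    · intro s
      refine Fin.cases ?_ (fun i => ?_) s <;> simp
  | succ n ih =>
    obtain ⟨c, hc, hb⟩ := ih
    let c' : Fin (d + 1) → ℤ := Fin.cons 0 (fun i : Fin d => c i.castSucc)
    have hc'b : ∀ s, |c' s| ≤ (1 + S : ℤ) ^ n := by
      intro s
      refine Fin.cases ?_ (fun i => ?_) s
      · simp only [c', Fin.cons_zero, abs_zero]; positivity
      · simp only [c', Fin.cons_succ]; exact_mod_cast hb _
    refine ⟨fun s => c' s - c (Fin.last d) * G.coeff s, ?_, ?_⟩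
    · rw [pow_succ, hc, Fin.sum_univ_castSucc, add_mul, Finset.sum_mul]
      have h2 : (c (Fin.last d) : ℝ) * α ^ ((Fin.last d : Fin (d + 1)) : ℕ) * α
          = -∑ s : Fin (d + 1), (c (Fin.last d) : ℝ) * ((G.coeff s : ℝ) * α ^ (s : ℕ)) := by
        rw [← Finset.mul_sum, mul_assoc, Fin.val_last, ← pow_succ, hαd]; ring
      have h3 : ∑ i : Fin d, (c i.castSucc : ℝ) * α ^ ((i.castSucc : Fin (d + 1)) : ℕ) * α
          = ∑ s : Fin (d + 1), (c' s : ℝ) * α ^ (s : ℕ) := by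
        rw [Fin.sum_univ_succ]
        simp only [c', Fin.cons_zero, Fin.cons_succ, Int.cast_zero, zero_mul, zero_add,
          Fin.val_castSucc, Fin.val_succ, pow_succ, mul_assoc]
      rw [h2, h3, ← sub_eq_add_neg, ← Finset.sum_sub_distrib]
      refine Finset.sum_congr rfl fun s _ => ?_
      push_cast; ring
    · intro s
      have h4 := hb (Fin.last d)
      have h5 := hc'b s
      have h6 := hS s
      push_cast at h4 ⊢
      calc |c' s - c (Fin.last d) * G.coeff s| ≤ |c' s| + |c (Fin.last d)| * |G.coeff s| := by
            rw [← abs_mul]; exact abs_sub _ _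
        _ ≤ (1 + S : ℤ) ^ n + (1 + S : ℤ) ^ n * S := by gcongr
        _ = _ := by ring


lemma inner_sum (r : ℕ) (hr : 0 < r) (lam : ℝ) :
    ∑ i : Fin (r + 1), exp (lam * (1 / 2 - (i : ℝ) / r)) ≤ (r + 1) * exp (lam ^ 2 / 8) := by
  have hr' : (0 : ℝ) < r := by exact_mod_cast hr
  have hrev : ∑ i : Fin (r + 1), exp (lam * (1 / 2 - (i : ℝ) / r))
      = ∑ i : Fin (r + 1), exp (-(lam * (1 / 2 - (i : ℝ) / r))) := by
    rw [← Equiv.sum_comp Fin.revPerm]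
    refine Finset.sum_congr rfl fun i _ => ?_
    congr 1
    have hi : (i : ℕ) ≤ r := Nat.lt_succ_iff.mp i.2
    rw [Fin.revPerm_apply, Fin.val_rev, show r + 1 - ((i : ℕ) + 1) = r - i by omega, Nat.cast_sub hi]
    field_simp
    ring
  have h2 : 2 * ∑ i : Fin (r + 1), exp (lam * (1 / 2 - (i : ℝ) / r))
      = ∑ i : Fin (r + 1), 2 * Real.cosh (lam * (1 / 2 - (i : ℝ) / r)) := by
    rw [two_mul]
    conv_lhs => rw [hrev]
    nth_rewrite 1 [← hrev]
    rw [← Finset.sum_add_distrib]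
    refine Finset.sum_congr rfl fun i _ => ?_
    rw [Real.cosh_eq]; ring
  have h3 : ∀ i : Fin (r + 1), 2 * Real.cosh (lam * (1 / 2 - (i : ℝ) / r)) ≤ 2 * exp (lam ^ 2 / 8) := by
    intro i
    have hi : (i : ℝ) / r ≤ 1 := by
      rw [div_le_one hr']
      exact_mod_cast Nat.lt_succ_iff.mp i.2
    have hi0 : 0 ≤ (i : ℝ) / r := by positivity
    refine mul_le_mul_of_nonneg_left ((Real.cosh_le_exp_half_sq _).trans (exp_le_exp.mpr ?_)) (by norm_num)
    have h5 : (1 / 2 - (i : ℝ) / r) ^ 2 ≤ 1 / 4 := by nlinarith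
    have : lam ^ 2 * (1 / 2 - (i : ℝ) / r) ^ 2 ≤ lam ^ 2 * (1 / 4) :=
      mul_le_mul_of_nonneg_left h5 (sq_nonneg _)
    rw [mul_pow]; linarith
  have h4 := Finset.sum_le_sum fun i (_ : i ∈ Finset.univ) => h3 i
  rw [← h2] at h4
  simp only [Finset.sum_const, Finset.card_univ, Fintype.card_fin, nsmul_eq_mul] at h4
  push_cast at h4
  linarith

lemma count_aux1 {m : ℕ} (r : Fin m → ℕ) (e : (j : Fin m) → Fin (r j + 1)) (ε : ℝ) (hε : 0 < ε)
    (he : ∑ j, ((e j : ℕ) : ℝ) / r j < m * (1 / 2 - ε)) :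
    (1 : ℝ) ≤ exp (-(4 * ε ^ 2 * m)) * ∏ j, exp (4 * ε * (1 / 2 - ((e j : ℕ) : ℝ) / r j)) := by
  rw [← Real.exp_sum, ← Real.exp_add, ← Finset.mul_sum, Finset.sum_sub_distrib]
  apply Real.one_le_exp
  simp only [Finset.sum_const, Finset.card_univ, Fintype.card_fin, nsmul_eq_mul]
  nlinarith

lemma count_aux2 {m : ℕ} (r : Fin m → ℕ) (g : (j : Fin m) → Fin (r j + 1) → ℝ) :
    ∑ e : ((j : Fin m) → Fin (r j + 1)), ∏ j, g j (e j) = ∏ j, ∑ i, g j i := by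
  rw [Finset.prod_univ_sum, Fintype.piFinset_univ]

lemma count_aux3 {m : ℕ} (r : Fin m → ℕ) (hr : ∀ j, 0 < r j) (ε : ℝ) :
    exp (-(4 * ε ^ 2 * m)) * ∏ j, ∑ i : Fin (r j + 1), exp (4 * ε * (1 / 2 - (i : ℝ) / r j)) ≤
    (∏ j, ((r j : ℝ) + 1)) * exp (-(2 * ε ^ 2 * m)) := by
  have h1 : ∏ j, ∑ i : Fin (r j + 1), exp (4 * ε * (1 / 2 - (i : ℝ) / r j))
      ≤ ∏ j, (((r j : ℝ) + 1) * exp ((4 * ε) ^ 2 / 8)) :=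
    Finset.prod_le_prod (fun j _ => Finset.sum_nonneg fun _ _ => (exp_pos _).le)
          (fun j _ => inner_sum (r j) (hr j) _)
  refine (mul_le_mul_of_nonneg_left h1 (exp_pos _).le).trans (le_of_eq ?_)
  rw [Finset.prod_mul_distrib, Finset.prod_const, Finset.card_univ, Fintype.card_fin,
    ← Real.exp_nat_mul, mul_left_comm, ← Real.exp_add]
  congr 2
  ring

lemma count {m : ℕ} (r : Fin m → ℕ) (hr : ∀ j, 0 < r j) (ε : ℝ) (hε : 0 < ε)
    (S : Finset ((j : Fin m) → Fin (r j + 1)))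
    (hS : ∀ e ∈ S, ∑ j, ((e j : ℕ) : ℝ) / r j < m * (1 / 2 - ε)) :
    (S.card : ℝ) ≤ (∏ j, ((r j : ℝ) + 1)) * exp (-(2 * ε ^ 2 * m)) := by
  refine le_trans ?_ (count_aux3 r hr ε)
  rw [← count_aux2 r (fun j i => exp (4 * ε * (1 / 2 - ((i : ℕ) : ℝ) / r j))), Finset.mul_sum]
  have h1 : (S.card : ℝ) = ∑ e ∈ S, (1 : ℝ) := by simp
  rw [h1]
  refine (Finset.sum_le_sum fun e he => count_aux1 r e ε hε (hS e he)).trans ?_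
  exact Finset.sum_le_sum_of_subset_of_nonneg (Finset.subset_univ _) (fun _ _ _ => by positivity)

end RothAux

namespace RothAux
open MvPolynomial

/-- the exponent vector attached to a point in a box -/
noncomputable def emb {m : ℕ} {r : Fin m → ℕ} (e : (j : Fin m) → Fin (r j + 1)) : Fin m →₀ ℕ :=
  Finsupp.equivFunOnFinite.symm (fun j => (e j : ℕ))

lemma emb_apply {m : ℕ} {r : Fin m → ℕ} (e : (j : Fin m) → Fin (r j + 1)) (j : Fin m) :
    emb e j = (e j : ℕ) := rfl

lemma emb_inj {m : ℕ} {r : Fin m → ℕ} :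
    Function.Injective (emb : ((j : Fin m) → Fin (r j + 1)) → Fin m →₀ ℕ) := by
  intro e f h
  funext j
  apply Fin.ext
  exact DFunLike.congr_fun h j

lemma aux_poly (α : ℝ) (G : Polynomial ℤ) (hG : G.Monic) (hd : 0 < G.natDegree)
    (hα : Polynomial.aeval α G = 0) : ∃ A : ℝ, 1 ≤ A ∧ ∀ (m : ℕ) (ε : ℝ), 0 < m → 0 < ε → ε < 1 / 2 →
      Real.log (2 * G.natDegree) ≤ 2 * ε ^ 2 * m → ∀ r : Fin m → ℕ, (∀ j, 0 < r j) →
      ∃ P : MvPolynomial (Fin m) ℤ, P ≠ 0 ∧ DegLE r P ∧ L1 P ≤ A ^ (∑ j, r j) ∧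
        IdxGE (fun j => 1 / (r j : ℝ)) (m * (1 / 2 - ε))
          (shift (fun _ => α) (map (Int.castRingHom ℝ) P)) := by
  classical
  obtain ⟨A, hA1, hA⟩ := pow_red α G hG hd hα
  choose c hc hb using hA
  have hA1' : (1 : ℝ) ≤ A := by exact_mod_cast hA1
  refine ⟨8 * A, by linarith, fun m ε hm hε hε2 hlog r hr => ?_⟩
  set S : Finset ((j : Fin m) → Fin (r j + 1)) := Finset.univ.filter fun e =>
      ∑ j, ((e j : ℕ) : ℝ) / r j < m * (1 / 2 - ε) with hS
  have hcount := count r hr ε hε S (fun e he => (Finset.mem_filter.mp he).2)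
  have hcard : Fintype.card ((j : Fin m) → Fin (r j + 1)) = ∏ j, (r j + 1) := by simp
  set N := Fintype.card ((j : Fin m) → Fin (r j + 1)) with hN
  have hNr : (N : ℝ) = ∏ j, ((r j : ℝ) + 1) := by rw [hcard]; push_cast; rfl
  rw [← hNr] at hcount
  have hdpos : (0 : ℝ) < G.natDegree := by exact_mod_cast hd
  have hNpos : (0 : ℝ) ≤ N := Nat.cast_nonneg _
  have h2card : 2 * Fintype.card (S × Fin G.natDegree) ≤ N := by
    rw [Fintype.card_prod, Fintype.card_coe, Fintype.card_fin]
    have h1 : (2 : ℝ) * G.natDegree * exp (-(2 * ε ^ 2 * m)) ≤ 1 := by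
      rw [Real.exp_neg, ← div_eq_mul_inv, div_le_one (exp_pos _)]
      rwa [Real.log_le_iff_le_exp (by positivity)] at hlog
    have h2 : (2 : ℝ) * (S.card * G.natDegree) ≤ N := by
      calc (2 : ℝ) * (S.card * G.natDegree)
          ≤ 2 * ((N * exp (-(2 * ε ^ 2 * m))) * G.natDegree) := by gcongr
        _ = N * (2 * G.natDegree * exp (-(2 * ε ^ 2 * m))) := by ring
        _ ≤ N * 1 := by gcongr
        _ = N := mul_one _
    exact_mod_cast h2
  have hSpos : 0 < Fintype.card (S × Fin G.natDegree) := by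
    rw [Fintype.card_prod, Fintype.card_coe, Fintype.card_fin]
    apply Nat.mul_pos _ hd
    refine Finset.card_pos.mpr ⟨fun j => 0, Finset.mem_filter.mpr ⟨Finset.mem_univ _, ?_⟩⟩
    have hm' : (0 : ℝ) < m := by exact_mod_cast hm
    simp only [Fin.val_zero, Nat.cast_zero, zero_div, Finset.sum_const_zero]
    exact mul_pos hm' (by linarith)
  set R := ∑ j, r j with hR
  let M : Matrix (S × Fin G.natDegree) ((j : Fin m) → Fin (r j + 1)) ℤ :=
    Matrix.of fun x e => (bin (emb x.1.1) (emb e) : ℤ) * c (∑ j, ((e j : ℕ) - (x.1.1 j : ℕ))) x.2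
  have hsumle : ∀ e : (j : Fin m) → Fin (r j + 1), ∑ j, (e j : ℕ) ≤ R :=
    fun e => Finset.sum_le_sum fun j _ => Nat.lt_succ_iff.mp (e j).2
  have hMb : ∀ x e, |(M x e : ℝ)| ≤ (2 * A : ℝ) ^ R := by
    intro x e
    simp only [M, Matrix.of_apply]
    push_cast
    rw [abs_mul, Nat.abs_cast, mul_pow]
    have h1 : (bin (emb x.1.1) (emb e) : ℝ) ≤ 2 ^ R := by
      have := (bin_le (emb x.1.1) (emb e)).trans (Nat.pow_le_pow_right (by norm_num) (hsumle e))
      exact_mod_cast this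
    have h2 : |(c (∑ j, ((e j : ℕ) - (x.1.1 j : ℕ))) x.2 : ℝ)| ≤ (A : ℝ) ^ R := by
      have h3 := hb (∑ j, ((e j : ℕ) - (x.1.1 j : ℕ))) x.2
      have h4 : |(c (∑ j, ((e j : ℕ) - (x.1.1 j : ℕ))) x.2 : ℝ)|
          ≤ (A : ℝ) ^ (∑ j, ((e j : ℕ) - (x.1.1 j : ℕ))) := by exact_mod_cast h3
      refine h4.trans (pow_le_pow_right₀ hA1' ?_)
      exact (Finset.sum_le_sum fun j _ => Nat.sub_le _ _).trans (hsumle e)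
    exact mul_le_mul h1 h2 (abs_nonneg _) (by positivity)
  obtain ⟨t, ht0, hMt, htb⟩ := siegel M ((2 * A : ℝ) ^ R) (one_le_pow₀ (by linarith)) hMb h2card hSpos
  let P : MvPolynomial (Fin m) ℤ := ∑ e, monomial (emb e) (t e)
  have hPc : ∀ e, coeff (emb e) P = t e := by
    intro e
    simp only [P, coeff_sum, coeff_monomial]
    rw [Finset.sum_eq_single e]
    · simp
    · intro f _ hf; rw [if_neg (fun h => hf (emb_inj h))]
    · simp
  refine ⟨P, ?_, ?_, ?_, ?_⟩
  · intro h
    apply ht0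
    funext e
    rw [← hPc, h]; simp
  · intro f hf j
    simp only [P, coeff_sum] at hf
    obtain ⟨e, _, he⟩ := Finset.exists_ne_zero_of_sum_ne_zero hf
    rw [coeff_monomial] at he
    have : emb e = f := by by_contra hc; rw [if_neg hc] at he; exact he rfl
    rw [← this, emb_apply]
    exact Nat.lt_succ_iff.mp (e j).2
  · have hN2 : (N : ℝ) ≤ 2 ^ R := by
      have : N ≤ 2 ^ R := by
        rw [hcard, hR, ← Finset.prod_pow_eq_pow_sum]
        exact Finset.prod_le_prod' fun j _ => Nat.lt_two_pow_self
      exact_mod_cast this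
    calc L1 P ≤ ∑ e, L1 (monomial (emb e) (t e)) := L1_sum _ _
      _ ≤ ∑ e : ((j : Fin m) → Fin (r j + 1)), (N : ℝ) * (2 * A : ℝ) ^ R :=
          Finset.sum_le_sum fun e _ => (L1_monomial _ _).trans (htb e)
      _ = N * (N * (2 * A : ℝ) ^ R) := by
          rw [Finset.sum_const, nsmul_eq_mul, Finset.card_univ]
      _ ≤ 2 ^ R * (2 ^ R * (2 * A : ℝ) ^ R) := by gcongr
      _ = (8 * A : ℝ) ^ R := by rw [← mul_pow, ← mul_pow]; ring
  · intro J hJ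
    by_contra hlt
    push Not at hlt
    apply hJ
    have hmap : map (Int.castRingHom ℝ) P = ∑ e, monomial (emb e) (t e : ℝ) := by
      simp only [P, map_sum, map_monomial, eq_intCast]
    rw [hmap, map_sum, coeff_sum]
    simp only [coeff_shift_monomial]
    by_cases hbox : ∃ j, r j < J j
    · obtain ⟨j, hj⟩ := hbox
      refine Finset.sum_eq_zero fun e _ => ?_
      have : bin J (emb e) = 0 := by
        refine Finset.prod_eq_zero (Finset.mem_univ j) (Nat.choose_eq_zero_of_lt ?_)
        rw [emb_apply]
        have := (e j).2
        omega
      rw [this]; simp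
    · push Not at hbox
      let J' : (j : Fin m) → Fin (r j + 1) := fun j => ⟨J j, Nat.lt_succ_iff.mpr (hbox j)⟩
      have hJJ : J = emb J' := by ext j; rfl
      have hJS : J' ∈ S := by
        refine Finset.mem_filter.mpr ⟨Finset.mem_univ _, ?_⟩
        refine lt_of_eq_of_lt ?_ hlt
        unfold wt
        refine Finset.sum_congr rfl fun j _ => ?_
        simp only [J']; ring
      have hrow : ∀ s, ∑ e, (M (⟨J', hJS⟩, s) e : ℝ) * (t e : ℝ) = 0 := by
        intro s
        have := congrFun hMt (⟨J', hJS⟩, s)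
        simp only [Matrix.mulVec, dotProduct, Pi.zero_apply] at this
        exact_mod_cast this
      have hterm : ∀ e : (j : Fin m) → Fin (r j + 1),
          (t e : ℝ) * ((bin J (emb e) : ℝ) * ∏ j, α ^ (emb e j - J j))
          = ∑ s : Fin G.natDegree, α ^ (s : ℕ) * ((M (⟨J', hJS⟩, s) e : ℝ) * (t e : ℝ)) := by
        intro e
        rw [Finset.prod_pow_eq_pow_sum]
        have : ∑ j, (emb e j - J j) = ∑ j, ((e j : ℕ) - (J' j : ℕ)) := rfl
        rw [this, hc, hJJ, Finset.mul_sum, Finset.mul_sum]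
        refine Finset.sum_congr rfl fun s _ => ?_
        simp only [M, Matrix.of_apply]
        push_cast
        ring
      rw [Finset.sum_congr rfl fun e _ => hterm e, Finset.sum_comm]
      refine Finset.sum_eq_zero fun s _ => ?_
      rw [← Finset.mul_sum, hrow, mul_zero]

end RothAux

namespace RothAux
open MvPolynomial

lemma shift_map {n : ℕ} {R S : Type*} [CommRing R] [CommRing S] (g : R →+* S) (γ : Fin n → R)
    (f : MvPolynomial (Fin n) R) : shift (fun j => g (γ j)) (map g f) = map g (shift γ f) := by
  induction f using MvPolynomial.induction_on with
  | C a => simp only [shift, map_C, aeval_C, algebraMap_eq]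
  | add p q hp hq => simp only [map_add, hp, hq]
  | mul_X p i hp =>
    rw [map_mul, map_mul, map_mul, map_mul, hp]
    congr 1
    simp [shift]

lemma shift_shift {n : ℕ} {R : Type*} [CommRing R] (γ γ' : Fin n → R)
    (f : MvPolynomial (Fin n) R) : shift γ (shift γ' f) = shift (fun j => γ j + γ' j) f := by
  induction f using MvPolynomial.induction_on with
  | C a => simp only [shift, aeval_C, algebraMap_eq]
  | add p q hp hq => simp only [map_add, hp, hq]
  | mul_X p i hp =>
    rw [map_mul, map_mul, map_mul, hp]
    congr 1
    simp only [shift, aeval_X, map_add, aeval_C, algebraMap_eq]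
    ring

lemma bin_ne_zero {n : ℕ} {J e : Fin n →₀ ℕ} (h : bin J e ≠ 0) (j : Fin n) : J j ≤ e j := by
  by_contra hc
  exact h (Finset.prod_eq_zero (Finset.mem_univ j) (Nat.choose_eq_zero_of_lt (by omega)))

lemma DegLE.shift {n : ℕ} {R : Type*} [CommRing R] {r : Fin n → ℕ} {f : MvPolynomial (Fin n) R}
    (h : DegLE r f) (γ : Fin n → R) : DegLE r (shift γ f) := by
  intro J hJ j
  rw [coeff_shift] at hJ
  obtain ⟨e, he, hne⟩ := Finset.exists_ne_zero_of_sum_ne_zero hJ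
  have h1 : bin J e ≠ 0 := by
    intro h0; rw [h0] at hne; simp at hne
  exact (bin_ne_zero h1 j).trans (h e (mem_support_iff.mp he) j)

lemma DegLE.map {n : ℕ} {r : Fin n → ℕ} {f : MvPolynomial (Fin n) ℤ} (h : DegLE r f) :
    DegLE r (MvPolynomial.map (Int.castRingHom ℝ) f) := by
  intro e he
  rw [coeff_map] at he
  apply h e
  intro h0; rw [h0] at he; simp at he

lemma coeff_shift_bound {n : ℕ} {r : Fin n → ℕ} {P : MvPolynomial (Fin n) ℤ} (h : DegLE r P)
    (γ : Fin n → ℝ) (a : ℝ) (ha : 1 ≤ a) (hγ : ∀ j, |γ j| ≤ a) (J : Fin n →₀ ℕ) :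
    |coeff J (shift γ (map (Int.castRingHom ℝ) P))| ≤ (2 * a) ^ (∑ j, r j) * L1 P := by
  rw [coeff_shift]
  have hsupp : (map (Int.castRingHom ℝ) P).support ⊆ P.support := support_map_subset _ _
  refine (Finset.abs_sum_le_sum_abs _ _).trans ?_
  refine (Finset.sum_le_sum_of_subset_of_nonneg hsupp (fun _ _ _ => abs_nonneg _)).trans ?_
  rw [L1, Finset.mul_sum]
  refine Finset.sum_le_sum fun e he => ?_
  have hle := h e (mem_support_iff.mp he)
  rw [coeff_map, eq_intCast, abs_mul, mul_comm]
  refine mul_le_mul_of_nonneg_right ?_ (abs_nonneg _)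
  rw [abs_mul, Nat.abs_cast, mul_pow]
  have h1 : (bin J e : ℝ) ≤ 2 ^ (∑ j, r j) := by
    have := (bin_le J e).trans (Nat.pow_le_pow_right (by norm_num) (Finset.sum_le_sum fun j _ => hle j))
    exact_mod_cast this
  refine mul_le_mul h1 ?_ (abs_nonneg _) (by positivity)
  rw [Finset.abs_prod, ← Finset.prod_pow_eq_pow_sum]
  refine Finset.prod_le_prod (fun j _ => abs_nonneg _) fun j _ => ?_
  rw [abs_pow]
  refine (pow_le_pow_left₀ (abs_nonneg _) (hγ j) _).trans (pow_le_pow_right₀ ha ?_)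
  exact (Nat.sub_le _ _).trans (hle j)

lemma int_lower {n : ℕ} {r : Fin n → ℕ} {P : MvPolynomial (Fin n) ℤ} (h : DegLE r P)
    (p : Fin n → ℤ) (q : Fin n → ℕ) (hq : ∀ j, 0 < q j) (J : Fin n →₀ ℕ)
    (hne : coeff J (shift (fun j => (p j : ℝ) / q j) (map (Int.castRingHom ℝ) P)) ≠ 0) :
    1 ≤ (∏ j, (q j : ℝ) ^ r j) *
      |coeff J (shift (fun j => (p j : ℝ) / q j) (map (Int.castRingHom ℝ) P))| := by
  have hq' : ∀ j, (q j : ℝ) ≠ 0 := fun j => by exact_mod_cast (hq j).ne'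
  have hpos : 0 < ∏ j, (q j : ℝ) ^ r j :=
    Finset.prod_pos fun j _ => pow_pos (by exact_mod_cast hq j) _
  obtain ⟨z, hz⟩ : ∃ z : ℤ, (∏ j, (q j : ℝ) ^ r j) *
      coeff J (shift (fun j => (p j : ℝ) / q j) (map (Int.castRingHom ℝ) P)) = z := by
    refine ⟨∑ e ∈ (map (Int.castRingHom ℝ) P).support, coeff e P * ((bin J e : ℤ) *
      ∏ j, (p j ^ (e j - J j) * (q j : ℤ) ^ (r j - (e j - J j)))), ?_⟩
    rw [coeff_shift, Finset.mul_sum]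
    push_cast
    refine Finset.sum_congr rfl fun e he => ?_
    have hle := h.map e (mem_support_iff.mp he)
    rw [coeff_map, eq_intCast]
    have : (∏ j, (q j : ℝ) ^ r j) * ∏ j, ((p j : ℝ) / q j) ^ (e j - J j)
        = ∏ j, ((p j : ℝ) ^ (e j - J j) * (q j : ℝ) ^ (r j - (e j - J j))) := by
      rw [← Finset.prod_mul_distrib]
      refine Finset.prod_congr rfl fun j _ => ?_
      have h1 : e j - J j ≤ r j := (Nat.sub_le _ _).trans (hle j)
      have h2 : (q j : ℝ) ^ r j = (q j : ℝ) ^ (r j - (e j - J j)) * (q j : ℝ) ^ (e j - J j) := by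
        rw [← pow_add]; congr 1; omega
      rw [h2, div_pow]
      have := pow_ne_zero (e j - J j) (hq' j)
      field_simp
    rw [← this]; ring
  have hz0 : z ≠ 0 := by
    intro h0
    rw [h0, Int.cast_zero] at hz
    exact (mul_ne_zero hpos.ne' hne) hz
  rw [← abs_of_pos hpos, ← abs_mul, hz]
  exact_mod_cast Int.one_le_abs hz0

lemma upper {n : ℕ} {r : Fin n → ℕ} (hr : ∀ j, 0 < r j) {P : MvPolynomial (Fin n) ℤ} (h : DegLE r P)
    (α a : ℝ) (ha : 1 ≤ a) (hα : |α| ≤ a) (p : Fin n → ℤ) (q : Fin n → ℕ) (hq : ∀ j, 0 < q j)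
    (Λ κ τ η : ℝ) (hκ : 0 ≤ κ) (hΛ0 : 0 ≤ Λ) (hΛ : ∀ j, Λ ≤ r j * Real.log (q j))
    (happ : ∀ j, |α - (p j : ℝ) / q j| ≤ exp (-(κ * Real.log (q j))))
    (hidx : IdxGE (fun j => 1 / (r j : ℝ)) τ (shift (fun _ => α) (map (Int.castRingHom ℝ) P)))
    (J : Fin n →₀ ℕ) (hJ : wt (fun j => 1 / (r j : ℝ)) J ≤ η) :
    |coeff J (shift (fun j => (p j : ℝ) / q j) (map (Int.castRingHom ℝ) P))|
      ≤ (8 * a) ^ (∑ j, r j) * L1 P * exp (-(κ * (Λ * (τ - η)))) := by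
  classical
  set F := shift (fun _ => α) (map (Int.castRingHom ℝ) P) with hF
  set R := ∑ j, r j with hR
  have h1 : shift (fun j => (p j : ℝ) / q j) (map (Int.castRingHom ℝ) P)
      = shift (fun j => (p j : ℝ) / q j - α) F := by
    rw [hF, shift_shift]; simp
  have hFdeg : DegLE r F := h.map.shift _
  rw [h1, coeff_shift]
  have hcard : F.support.card ≤ 2 ^ R := by
    have hsub : F.support ⊆ Finset.univ.image (emb : ((j : Fin n) → Fin (r j + 1)) → _) := by
      intro e he
      have hle := hFdeg e (mem_support_iff.mp he)
      exact Finset.mem_image.mpr ⟨fun j => ⟨e j, Nat.lt_succ_iff.mpr (hle j)⟩, Finset.mem_univ _,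
        by ext j; rfl⟩
    refine (Finset.card_le_card hsub).trans (Finset.card_image_le.trans ?_)
    rw [Finset.card_univ]
    simp only [Fintype.card_pi, Fintype.card_fin]
    rw [hR, ← Finset.prod_pow_eq_pow_sum]
    exact Finset.prod_le_prod' fun j _ => Nat.lt_two_pow_self
  have hterm : ∀ I ∈ F.support, |coeff I F * ((bin J I : ℝ) * ∏ j, ((p j : ℝ) / q j - α) ^ (I j - J j))|
      ≤ (2 * a) ^ R * L1 P * (2 ^ R * exp (-(κ * (Λ * (τ - η))))) := by
    intro I hI
    have hc := coeff_shift_bound h (fun _ => α) a ha (fun _ => hα) I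
    have hle := hFdeg I (mem_support_iff.mp hI)
    have hL := L1_nonneg P
    by_cases hb : bin J I = 0
    · rw [hb]; simp only [Nat.cast_zero, zero_mul, mul_zero, abs_zero]; positivity
    have hJI := bin_ne_zero hb
    rw [abs_mul, abs_mul, Nat.abs_cast]
    have h2 : (bin J I : ℝ) ≤ 2 ^ R := by
      have := (bin_le J I).trans (Nat.pow_le_pow_right (by norm_num) (Finset.sum_le_sum fun j _ => hle j))
      exact_mod_cast this
    have h3 : |∏ j, ((p j : ℝ) / q j - α) ^ (I j - J j)| ≤ exp (-(κ * (Λ * (τ - η)))) := by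
      rw [Finset.abs_prod]
      have h4 : ∀ j, |((p j : ℝ) / q j - α) ^ (I j - J j)|
          ≤ exp (-(κ * (Λ * (1 / (r j : ℝ) * ((I j : ℝ) - J j))))) := by
        intro j
        rw [abs_pow, abs_sub_comm]
        refine (pow_le_pow_left₀ (abs_nonneg _) (happ j) _).trans ?_
        rw [← Real.exp_nat_mul, Nat.cast_sub (hJI j)]
        apply exp_le_exp.mpr
        have h5 : (0 : ℝ) ≤ (I j : ℝ) - J j := by
          have : (J j : ℝ) ≤ I j := by exact_mod_cast hJI j
          linarith
        have hrj : (0 : ℝ) < r j := by exact_mod_cast hr j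
        have h6 : Λ * (1 / (r j : ℝ)) ≤ Real.log (q j) := by
          rw [mul_one_div, div_le_iff₀ hrj, mul_comm]; exact hΛ j
        have h7 : κ * ((Λ * (1 / (r j : ℝ))) * ((I j : ℝ) - J j))
            ≤ κ * (Real.log (q j) * ((I j : ℝ) - J j)) :=
          mul_le_mul_of_nonneg_left (mul_le_mul_of_nonneg_right h6 h5) hκ
        linarith
      refine (Finset.prod_le_prod (fun j _ => abs_nonneg _) fun j _ => h4 j).trans ?_
      rw [← Real.exp_sum]
      apply exp_le_exp.mpr
      rw [Finset.sum_neg_distrib, neg_le_neg_iff, ← Finset.mul_sum, ← Finset.mul_sum]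
      refine mul_le_mul_of_nonneg_left (mul_le_mul_of_nonneg_left ?_ hΛ0) hκ
      have h8 := hidx I (mem_support_iff.mp hI)
      have h9 : ∑ j, 1 / (r j : ℝ) * ((I j : ℝ) - J j)
          = wt (fun j => 1 / (r j : ℝ)) I - wt (fun j => 1 / (r j : ℝ)) J := by
        simp only [wt, mul_sub, Finset.sum_sub_distrib]
      rw [h9]; linarith
    exact mul_le_mul hc (mul_le_mul h2 h3 (abs_nonneg _) (by positivity)) (by positivity) (by positivity)
  refine (Finset.abs_sum_le_sum_abs _ _).trans ((Finset.sum_le_sum hterm).trans ?_)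
  rw [Finset.sum_const, nsmul_eq_mul]
  have hcard' : (F.support.card : ℝ) ≤ 2 ^ R := by exact_mod_cast hcard
  have hL := L1_nonneg P
  calc (F.support.card : ℝ) * ((2 * a) ^ R * L1 P * (2 ^ R * exp (-(κ * (Λ * (τ - η))))))
      ≤ 2 ^ R * ((2 * a) ^ R * L1 P * (2 ^ R * exp (-(κ * (Λ * (τ - η)))))) := by gcongr
    _ = (2 ^ R * (2 * a) ^ R * 2 ^ R) * L1 P * exp (-(κ * (Λ * (τ - η)))) := by ring
    _ = _ := by rw [← mul_pow, ← mul_pow]; congr 3; ring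

end RothAux

namespace RothAux
open MvPolynomial

set_option maxHeartbeats 1000000 in
lemma roth_core (α : ℝ) (G : Polynomial ℤ) (hG : G.Monic) (hd : 0 < G.natDegree)
    (hα : Polynomial.aeval α G = 0) (ε : ℝ) (hε : 0 < ε) (hε2 : ε ≤ 1 / 20) :
    ∃ (m : ℕ) (M L0 : ℝ), 1 ≤ M ∧ 0 < L0 ∧ ∀ (p : Fin m → ℤ) (q : Fin m → ℕ), (∀ j, 0 < q j) →
      (∀ j, IsCoprime (p j) (q j : ℤ)) → (∀ j, L0 ≤ Real.log (q j)) →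
      (∀ i j, i < j → M * Real.log (q j) ≤ Real.log (q i)) →
      (∀ j, |α - (p j : ℝ) / q j| ≤ exp (-((2 + 20 * ε) * Real.log (q j)))) → False := by
  obtain ⟨A, hA1, hA⟩ := aux_poly α G hG hd hα
  obtain ⟨m0, hm0⟩ := exists_nat_ge (Real.log (2 * G.natDegree) / (2 * ε ^ 2))
  set m := m0 + 1 with hm
  have hmpos : 0 < m := Nat.succ_pos _
  have hm1 : (1 : ℝ) ≤ m := by exact_mod_cast hmpos
  have hmlog : Real.log (2 * G.natDegree) ≤ 2 * ε ^ 2 * m := by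
    rw [div_le_iff₀ (by positivity)] at hm0
    have : (m0 : ℝ) ≤ m := by rw [hm]; push_cast; linarith
    nlinarith [sq_nonneg ε, mul_le_mul_of_nonneg_right this (by positivity : 0 ≤ 2 * ε ^ 2)]
  obtain ⟨ω, hω, hroth⟩ := roth_lemma m ε hε
  set a := max 1 |α| with ha
  have ha1 : 1 ≤ a := le_max_left _ _
  have haα : |α| ≤ a := le_max_right _ _
  have hlA : 0 ≤ Real.log A := Real.log_nonneg hA1
  have h8aA : 1 ≤ 8 * a * A := by nlinarith
  have hl8 : 0 ≤ Real.log (8 * a * A) := Real.log_nonneg h8aA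
  set L0 : ℝ := 1 + 2 / ω + 2 * m * Real.log A / ω + 2 * m * Real.log (8 * a * A) / ε with hL0
  have t1 : 0 ≤ 2 / ω := by positivity
  have t2 : 0 ≤ 2 * m * Real.log A / ω := by positivity
  have t3 : 0 ≤ 2 * m * Real.log (8 * a * A) / ε := by positivity
  have hL0pos : 0 < L0 := by rw [hL0]; linarith
  refine ⟨m, max 1 (2 / ω), L0, le_max_left _ _, hL0pos, ?_⟩
  intro p q hq hcop hlog hmono happ
  have hl : ∀ j, 0 < Real.log (q j) := fun j => hL0pos.trans_le (hlog j)
  set Λ : ℝ := (∑ j, Real.log (q j)) / ε with hΛdef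
  have hlΛ : ∀ j, Real.log (q j) ≤ ε * Λ := by
    intro j
    rw [hΛdef, mul_div_cancel₀ _ hε.ne']
    exact Finset.single_le_sum (f := fun j => Real.log (q j)) (fun i _ => (hl i).le) (Finset.mem_univ j)
  have hΛ : 0 < Λ := by
    have := (hl ⟨0, hmpos⟩).trans_le (hlΛ ⟨0, hmpos⟩)
    exact pos_of_mul_pos_right this hε.le
  set r : Fin m → ℕ := fun j => ⌊Λ / Real.log (q j)⌋₊ + 1 with hr
  have hrpos : ∀ j, 0 < r j := fun j => Nat.succ_pos _
  have hr1 : ∀ j, Λ ≤ r j * Real.log (q j) := by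
    intro j
    rw [← div_le_iff₀ (hl j), hr]; push_cast
    exact (Nat.lt_floor_add_one _).le
  have hr2 : ∀ j, (r j : ℝ) * Real.log (q j) ≤ Λ + Real.log (q j) := by
    intro j
    have : (r j : ℝ) ≤ Λ / Real.log (q j) + 1 := by
      rw [hr]; push_cast
      have := Nat.floor_le (div_nonneg hΛ.le (hl j).le)
      linarith
    calc _ ≤ (Λ / Real.log (q j) + 1) * Real.log (q j) := by gcongr
      _ = _ := by rw [add_mul, div_mul_cancel₀ _ (hl j).ne', one_mul]
  have hr3 : ∀ j, (r j : ℝ) * Real.log (q j) ≤ (1 + ε) * Λ := fun j => by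
    have := hr2 j; have := hlΛ j; linarith
  have hr4 : ∀ j, (r j : ℝ) * Real.log (q j) ≤ 2 * Λ := fun j => by
    have := hr3 j; nlinarith
  have hr5 : ∀ j, (r j : ℝ) * L0 ≤ 2 * Λ := fun j =>
    (mul_le_mul_of_nonneg_left (hlog j) (Nat.cast_nonneg _)).trans (hr4 j)
  have hr6 : ∀ j, (r j : ℝ) ≤ ω * Λ := by
    intro j
    have h1 := hr5 j
    have h2 : (r j : ℝ) * (2 / ω) ≤ 2 * Λ :=
      (mul_le_mul_of_nonneg_left (by rw [hL0]; linarith) (Nat.cast_nonneg _)).trans h1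
    rw [mul_div_assoc', div_le_iff₀ hω] at h2
    linarith
  have hr7 : ∀ i j, i < j → (r i : ℝ) ≤ ω * r j := by
    intro i j hij
    have h1 := hmono i j hij
    have h2 : 2 / ω * Real.log (q j) ≤ Real.log (q i) :=
      (mul_le_mul_of_nonneg_right (le_max_right _ _) (hl j).le).trans h1
    have h3 : (r i : ℝ) * (2 / ω * Real.log (q j)) ≤ 2 * (r j * Real.log (q j)) :=
      (mul_le_mul_of_nonneg_left h2 (Nat.cast_nonneg _)).trans ((hr4 i).trans (by linarith [hr1 j]))
    have h4 : ((r i : ℝ) * (2 / ω)) * Real.log (q j) ≤ (2 * r j) * Real.log (q j) := by linarith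
    have h5 := le_of_mul_le_mul_right h4 (hl j)
    rw [mul_div_assoc', div_le_iff₀ hω] at h5
    linarith
  have hsum : ((∑ j, r j : ℕ) : ℝ) * L0 ≤ 2 * m * Λ := by
    push_cast
    rw [Finset.sum_mul]
    refine (Finset.sum_le_sum fun j _ => hr5 j).trans ?_
    rw [Finset.sum_const, Finset.card_univ, Fintype.card_fin, nsmul_eq_mul]; linarith
  have hpow : ∀ (B c : ℝ), 1 ≤ B → 0 < c → 2 * m * Real.log B / c ≤ L0 →
      B ^ (∑ j, r j) ≤ exp (c * Λ) := by
    intro B c hB hc hBc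
    rw [← Real.exp_log (by positivity : 0 < B), ← Real.exp_nat_mul]
    apply exp_le_exp.mpr
    rw [div_le_iff₀ hc] at hBc
    have hlB := Real.log_nonneg hB
    have h1 : (((∑ j, r j : ℕ) : ℝ) * Real.log B) * L0 ≤ (c * Λ) * L0 := by
      calc (((∑ j, r j : ℕ) : ℝ) * Real.log B) * L0 = (((∑ j, r j : ℕ) : ℝ) * L0) * Real.log B := by ring
        _ ≤ (2 * m * Λ) * Real.log B := by gcongr
        _ = Λ * (2 * m * Real.log B) := by ring
        _ ≤ Λ * (L0 * c) := by gcongr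
        _ = _ := by ring
    exact le_of_mul_le_mul_right h1 hL0pos
  obtain ⟨P, hP0, hPdeg, hPL, hPidx⟩ := hA m ε hmpos hε (by linarith) hmlog r hrpos
  have hPL2 : L1 P ≤ exp (ω * Λ) :=
    hPL.trans (hpow A ω hA1 hω (by rw [hL0]; linarith))
  obtain ⟨J, hJne, hJ⟩ := hroth r p q Λ P hrpos hr7 hq hcop hr1 hr6 hP0 hPdeg hPL2
  have hJne' : coeff J (shift (fun j => (p j : ℝ) / q j) (map (Int.castRingHom ℝ) P)) ≠ 0 := by
    have h1 : shift (fun j => (p j : ℝ) / q j) (map (Int.castRingHom ℝ) P)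
        = map (Rat.castHom ℝ) (shift (fun j => (p j : ℚ) / q j) (map (Int.castRingHom ℚ) P)) := by
      rw [← shift_map, map_map]
      congr 2
      · funext j; simp
    rw [h1, coeff_map]
    exact (map_ne_zero _).mpr hJne
  have hlow := int_lower hPdeg p q hq J hJne'
  have hup := upper hrpos hPdeg α a ha1 haα p q hq Λ (2 + 20 * ε) _ ε (by positivity) hΛ.le hr1 happ
    hPidx J hJ
  have hprod : (∏ j, (q j : ℝ) ^ r j) ≤ exp (m * (1 + ε) * Λ) := by
    have : ∀ j, (q j : ℝ) ^ r j = exp (r j * Real.log (q j)) := by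
      intro j
      rw [Real.exp_nat_mul, Real.exp_log (by exact_mod_cast hq j)]
    simp_rw [this]
    rw [← Real.exp_sum]
    apply exp_le_exp.mpr
    refine (Finset.sum_le_sum fun j _ => hr3 j).trans ?_
    rw [Finset.sum_const, Finset.card_univ, Fintype.card_fin, nsmul_eq_mul]; linarith
  have hB : (8 * a) ^ (∑ j, r j) * L1 P ≤ exp (ε * Λ) := by
    calc (8 * a) ^ (∑ j, r j) * L1 P ≤ (8 * a) ^ (∑ j, r j) * A ^ (∑ j, r j) := by gcongr
      _ = (8 * a * A) ^ (∑ j, r j) := by rw [mul_pow (8 * a) A]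
      _ ≤ _ := hpow _ ε h8aA hε (by rw [hL0]; linarith)
  have hfin : (1 : ℝ) ≤ exp (m * (1 + ε) * Λ) * (exp (ε * Λ) *
      exp (-((2 + 20 * ε) * (Λ * (m * (1 / 2 - ε) - ε))))) := by
    refine hlow.trans ?_
    refine mul_le_mul hprod (hup.trans ?_) (abs_nonneg _) (exp_pos _).le
    exact mul_le_mul_of_nonneg_right hB (exp_pos _).le
  rw [← Real.exp_add, ← Real.exp_add, Real.one_le_exp_iff] at hfin
  have hneg : m * (1 + ε) + ε - (2 + 20 * ε) * (m * (1 / 2 - ε) - ε) < 0 := by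
    have e1 : ε ≤ m * ε := by nlinarith
    have e2 : (2 + 20 * ε) * (m * (1 / 2 - ε) - ε) ≥ (2 + 20 * ε) * (m * (1 / 2 - ε) - m * ε) := by
      gcongr
    have e3 : (2 + 20 * ε) * (m * (1 / 2 - ε) - m * ε) = m * (1 + 6 * ε - 40 * ε ^ 2) := by ring
    have e4 : m * (1 + 6 * ε - 40 * ε ^ 2) ≥ m * (1 + 4 * ε) := by
      gcongr; nlinarith
    have e5 : 0 < m * ε := by positivity
    linarith
  have := mul_neg_of_neg_of_pos hneg hΛ
  linarith

lemma roth_int (α : ℝ) (G : Polynomial ℤ) (hG : G.Monic) (hd : 0 < G.natDegree)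
    (hα : Polynomial.aeval α G = 0) (ε : ℝ) (hε : 0 < ε) (hε2 : ε ≤ 1 / 20) :
    ∃ Q : ℝ, ∀ (p : ℤ) (q : ℕ), 0 < q → IsCoprime p (q : ℤ) →
      |α - (p : ℝ) / q| ≤ exp (-((2 + 20 * ε) * Real.log q)) → Real.log q ≤ Q := by
  obtain ⟨m, M, L0, hM, hL0, hcore⟩ := roth_core α G hG hd hα ε hε hε2
  by_contra! hcon
  choose fp fq h1 h2 h3 h4 using hcon
  let t : ℕ → ℝ := fun n => Nat.rec L0 (fun _ T => max T (M * Real.log (fq T))) n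
  have ht0 : t 0 = L0 := rfl
  have hts : ∀ n, t (n + 1) = max (t n) (M * Real.log (fq (t n))) := fun n => rfl
  have htm : Monotone t := monotone_nat_of_le_succ fun n => by rw [hts]; exact le_max_left _ _
  have hL : ∀ n, L0 ≤ t n := fun n => htm (Nat.zero_le n)
  refine hcore (fun j => fp (t (Fin.rev j))) (fun j => fq (t (Fin.rev j))) (fun j => h1 _)
    (fun j => h2 _) (fun j => (hL _).trans (h4 _).le) ?_ (fun j => h3 _)
  intro i j hij
  have hlt : (Fin.rev j : ℕ) + 1 ≤ Fin.rev i := by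
    have : Fin.rev j < Fin.rev i := Fin.rev_lt_rev.mpr hij
    exact this
  have h5 : M * Real.log (fq (t (Fin.rev j))) ≤ t ((Fin.rev j : ℕ) + 1) := by
    rw [hts]; exact le_max_right _ _
  exact h5.trans ((htm hlt).trans (h4 _).le)

end RothAux

namespace RothAux
open MvPolynomial

lemma small_denoms (β : ℝ) (hβ : Irrational β) (N : ℕ) : ∃ c : ℝ, 0 < c ∧ c ≤ 1 ∧
    ∀ (p : ℤ) (q : ℕ), 0 < q → q ≤ N → c ≤ |q * β - p| := by
  induction N with
  | zero => exact ⟨1, one_pos, le_rfl, fun p q h1 h2 => by omega⟩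
  | succ N ih =>
    obtain ⟨c, hc, hc1, h⟩ := ih
    have hirr : Irrational (((N + 1 : ℕ) : ℝ) * β) := hβ.natCast_mul (Nat.succ_ne_zero N)
    have hpos : 0 < |((N + 1 : ℕ) : ℝ) * β - round (((N + 1 : ℕ) : ℝ) * β)| := by
      rw [abs_pos, sub_ne_zero]; exact hirr.ne_int _
    refine ⟨min c |((N + 1 : ℕ) : ℝ) * β - round (((N + 1 : ℕ) : ℝ) * β)|, lt_min hc hpos,
      (min_le_left _ _).trans hc1, fun p q h1 h2 => ?_⟩
    rcases Nat.lt_or_ge N q with h3 | h3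
    · have : q = N + 1 := by omega
      subst this
      exact (min_le_right _ _).trans (round_le _ _)
    · exact (min_le_left _ _).trans (h p q h1 h3)

lemma roth_integral (β : ℝ) (hirr : Irrational β) (hinteg : IsIntegral ℤ β) (δ : ℝ) (hδ : 0 < δ) :
    ∃ c : ℝ, 0 < c ∧ ∀ (p : ℤ) (q : ℕ), 0 < q → c * (q : ℝ) ^ (-(1 + δ)) ≤ |q * β - p| := by
  obtain ⟨G, hG, hGe⟩ := hinteg
  have hd : 0 < G.natDegree := by
    rw [Nat.pos_iff_ne_zero]
    intro h0
    rw [hG.natDegree_eq_zero] at h0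
    simp [h0] at hGe
  set ε := min δ 1 / 20 with hε
  have hm : 0 < min δ 1 := lt_min hδ one_pos
  have hε20 : 20 * ε = min δ 1 := by rw [hε]; ring
  obtain ⟨Q, hQ⟩ := roth_int β G hG hd hGe ε (by positivity)
    (by rw [hε]; have := min_le_right δ 1; linarith)
  obtain ⟨N, hN⟩ := exists_nat_ge (exp Q)
  obtain ⟨c, hc, hc1, hsm⟩ := small_denoms β hirr N
  have key : ∀ (p : ℤ) (q : ℕ), 0 < q → IsCoprime p (q : ℤ) →
      c * (q : ℝ) ^ (-(1 + δ)) ≤ |q * β - p| := by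
    intro p q hq hcop
    have hq1 : (1 : ℝ) ≤ q := by exact_mod_cast hq
    have hq0 : (0 : ℝ) < q := by linarith
    by_cases hlog : Real.log q ≤ Q
    · have : (q : ℝ) ≤ N := by
        rw [← Real.exp_log hq0]; exact (exp_le_exp.mpr hlog).trans hN
      refine le_trans ?_ (hsm p q hq (by exact_mod_cast this))
      have : (q : ℝ) ^ (-(1 + δ)) ≤ 1 := Real.rpow_le_one_of_one_le_of_nonpos hq1 (by linarith)
      nlinarith
    · have h1 : exp (-((2 + 20 * ε) * Real.log q)) < |β - (p : ℝ) / q| := by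
        by_contra! hh
        exact hlog (hQ p q hq hcop hh)
      have h2 : |q * β - p| = q * |β - (p : ℝ) / q| := by
        rw [← abs_of_pos hq0, ← abs_mul, abs_of_pos hq0]; congr 1; field_simp
      rw [h2]
      have h3 : (q : ℝ) ^ (-(1 + δ)) ≤ q * exp (-((2 + 20 * ε) * Real.log q)) := by
        conv_rhs => rw [← Real.exp_log hq0]
        rw [Real.rpow_def_of_pos hq0, ← Real.exp_add]
        apply exp_le_exp.mpr
        rw [Real.log_exp, hε20]
        have := min_le_left δ 1
        have := Real.log_nonneg hq1
        nlinarith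
      have h4 : 0 ≤ (q : ℝ) ^ (-(1 + δ)) := by positivity
      calc c * (q : ℝ) ^ (-(1 + δ)) ≤ (q : ℝ) ^ (-(1 + δ)) := by nlinarith
        _ ≤ _ := h3.trans (mul_le_mul_of_nonneg_left h1.le hq0.le)
  refine ⟨c, hc, fun p q hq => ?_⟩
  have hqz : (q : ℤ) ≠ 0 := by exact_mod_cast hq.ne'
  obtain ⟨g, p', q', hg, hcop, hp, hqq⟩ : ∃ (g : ℕ) (p' : ℤ) (q' : ℕ), 0 < g ∧ IsCoprime p' (q' : ℤ) ∧
      p = g * p' ∧ q = g * q' := by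
    have hgp : 0 < Int.gcd p q := Int.gcd_pos_of_ne_zero_right _ hqz
    obtain ⟨p', hp'⟩ := Int.gcd_dvd_left p q
    obtain ⟨q', hq'⟩ : Int.gcd p q ∣ q := by
      have := Int.gcd_dvd_right p q
      exact_mod_cast this
    refine ⟨Int.gcd p q, p', q', hgp, ?_, hp', hq'⟩
    rw [Int.isCoprime_iff_gcd_eq_one]
    have h1 := Int.gcd_mul_left (Int.gcd p q) p' q'
    have h2 : (q : ℤ) = Int.gcd p q * q' := by exact_mod_cast hq'
    rw [← hp', ← h2, Int.natAbs_natCast] at h1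
    exact Nat.eq_of_mul_eq_mul_left hgp (by omega)
  have hq' : 0 < q' := Nat.pos_of_ne_zero fun h => by subst h; simp at hqq; omega
  have h1 := key p' q' hq' hcop
  have hg1 : (1 : ℝ) ≤ g := by exact_mod_cast hg
  have h2 : |q * β - p| = g * |q' * β - p'| := by
    rw [hp, hqq]; push_cast
    rw [← abs_of_nonneg (by linarith : (0 : ℝ) ≤ g), ← abs_mul, abs_of_nonneg (by linarith : (0 : ℝ) ≤ g)]
    congr 1; ring
  have h3 : (q : ℝ) ^ (-(1 + δ)) ≤ (q' : ℝ) ^ (-(1 + δ)) := by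
    apply Real.rpow_le_rpow_of_nonpos (by exact_mod_cast hq') _ (by linarith)
    rw [hqq]; push_cast
    have : (0 : ℝ) ≤ q' := Nat.cast_nonneg _
    nlinarith
  rw [h2]
  have h4 := abs_nonneg (q' * β - p')
  calc c * (q : ℝ) ^ (-(1 + δ)) ≤ c * (q' : ℝ) ^ (-(1 + δ)) := by gcongr
    _ ≤ |q' * β - p'| := h1
    _ ≤ _ := by nlinarith

lemma roth (α : ℝ) (hirr : Irrational α) (halg : IsAlgebraic ℚ α) (δ : ℝ) (hδ : 0 < δ) :
    ∃ c : ℝ, 0 < c ∧ ∀ (p : ℤ) (q : ℕ), 0 < q → c * (q : ℝ) ^ (-(1 + δ)) ≤ |q * α - p| := by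
  have halgZ : IsAlgebraic ℤ α := (IsFractionRing.isAlgebraic_iff ℤ ℚ ℝ).mpr halg
  obtain ⟨D, hD, hinteg⟩ := halgZ.exists_integral_multiple
  have hDr : (D : ℝ) ≠ 0 := by exact_mod_cast hD
  rw [zsmul_eq_mul] at hinteg
  obtain ⟨c, hc, h⟩ := roth_integral (D * α) (hirr.intCast_mul hD) hinteg δ hδ
  refine ⟨c / |(D : ℝ)|, by positivity, fun p q hq => ?_⟩
  have h1 := h (D * p) q hq
  have h2 : |q * (D * α) - ((D * p : ℤ) : ℝ)| = |(D : ℝ)| * |q * α - p| := by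
    rw [← abs_mul]; congr 1; push_cast; ring
  rw [h2] at h1
  rw [div_mul_eq_mul_div, div_le_iff₀ (by positivity)]
  linarith

lemma nid_eq (t : ℝ) : nearestIntDist t = |t - round t| := by
  rw [nearestIntDist, abs_sub_round_eq_min]

/-- sum of reciprocals of distances -/
lemma sum_recip (α : ℝ) (hirr : Irrational α) (halg : IsAlgebraic ℚ α) (ε : ℝ) (hε : 0 < ε) :
    ∃ C : ℝ, 0 < C ∧ ∀ N : ℕ, 0 < N →
      ∑ h ∈ Finset.Icc 1 N, 1 / nearestIntDist (α * (h : ℝ)) ≤ C * (N : ℝ) ^ (1 + ε) := by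
  set δ := min ε 1 / 3 with hδdef
  have hm : 0 < min ε 1 := lt_min hε one_pos
  have hδ : 0 < δ := by positivity
  have hδε : (1 + δ) * (1 + δ) ≤ 1 + ε := by
    have h1 := min_le_left ε 1
    have h2 := min_le_right ε 1
    have : min ε 1 = 3 * δ := by rw [hδdef]; ring
    rw [this] at h1 h2
    nlinarith
  obtain ⟨c, hc, hroth⟩ := roth α hirr halg δ hδ
  have hsum : Summable fun n : ℤ => |(n : ℝ)| ^ (-(1 + δ)) :=
    Real.summable_abs_int_rpow (by linarith)
  set Z := ∑' n : ℤ, |(n : ℝ)| ^ (-(1 + δ)) with hZ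
  have hZ0 : 0 ≤ Z := tsum_nonneg fun n => by positivity
  refine ⟨(2 / c) ^ (1 + δ) * (Z + 1), by positivity, fun N hN => ?_⟩
  have hN1 : (1 : ℝ) ≤ N := by exact_mod_cast hN
  have hN0 : (0 : ℝ) < N := by linarith
  set s := c * (N : ℝ) ^ (-(1 + δ)) with hs
  have hs0 : 0 < s := by positivity
  have hsep : ∀ (p : ℤ) (q : ℕ), 0 < q → q ≤ N → s ≤ |q * α - p| := by
    intro p q hq hqN
    refine le_trans ?_ (hroth p q hq)
    rw [hs]
    gcongr 1
    exact Real.rpow_le_rpow_of_nonpos (by exact_mod_cast hq) (by exact_mod_cast hqN) (by linarith)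
  set u : ℕ → ℝ := fun h => α * h - round (α * h) with hu
  have hu1 : ∀ h ∈ Finset.Icc 1 N, s ≤ |u h| := by
    intro h hh
    rw [Finset.mem_Icc] at hh
    have := hsep (round (α * h)) h hh.1 hh.2
    rw [mul_comm] at this
    exact this
  have hu2 : ∀ h h' : ℕ, h < h' → h' ≤ N → s ≤ |u h' - u h| := by
    intro h h' hlt hle
    have := hsep (round (α * h') - round (α * h)) (h' - h) (by omega) (by omega)
    rw [Nat.cast_sub hlt.le] at this
    convert this using 2
    rw [hu]; push_cast; ring
  set k : ℕ → ℤ := fun h => ⌊u h / s⌋ with hk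
  have hfl : ∀ h, (k h : ℝ) * s ≤ u h ∧ u h < ((k h : ℝ) + 1) * s := by
    intro h
    constructor
    · rw [← le_div_iff₀ hs0]; exact Int.floor_le _
    · rw [← div_lt_iff₀ hs0]; exact Int.lt_floor_add_one _
  have hinj : Set.InjOn k (Finset.Icc 1 N : Finset ℕ) := by
    have aux : ∀ h h' : ℕ, h < h' → h' ≤ N → k h ≠ k h' := by
      intro h h' hlt hle heq
      have h1 := hu2 h h' hlt hle
      have h2 := hfl h
      have h3 := hfl h'
      rw [heq] at h2
      have : |u h' - u h| < s := by rw [abs_lt]; constructor <;> linarith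
      linarith
    intro h hh h' hh' heq
    simp only [Finset.coe_Icc, Set.mem_Icc] at hh hh'
    rcases lt_trichotomy h h' with h1 | h1 | h1
    · exact absurd heq (aux h h' h1 hh'.2)
    · exact h1
    · exact absurd heq.symm (aux h' h h1 hh.2)
  have hterm : ∀ h ∈ Finset.Icc 1 N, 1 / nearestIntDist (α * (h : ℝ))
      ≤ (2 / s) ^ (1 + δ) * |(k h : ℝ)| ^ (-(1 + δ)) := by
    intro h hh
    have h1 := hu1 h hh
    have h2 := hfl h
    have hd : nearestIntDist (α * (h : ℝ)) = |u h| := nid_eq _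
    rw [hd]
    have hupos : 0 < |u h| := hs0.trans_le h1
    have hu12 : |u h| ≤ 1 := (abs_sub_round _).trans (by norm_num)
    have hkk : 0 < |(k h : ℝ)| ∧ |(k h : ℝ)| * s / 2 ≤ |u h| := by
      rcases le_or_gt 0 (u h) with h3 | h3
      · rw [abs_of_nonneg h3] at h1 ⊢
        have hk1 : (1 : ℤ) ≤ k h := by
          rw [hk]; apply Int.le_floor.mpr; rw [le_div_iff₀ hs0]; push_cast; linarith
        have hk1' : (1 : ℝ) ≤ k h := by exact_mod_cast hk1
        rw [abs_of_pos (by linarith)]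
        exact ⟨by linarith, by nlinarith⟩
      · rw [abs_of_neg h3] at h1 ⊢
        have hk1 : k h ≤ -1 := by
          have : k h < 0 := by
            rw [hk]; apply Int.floor_lt.mpr; rw [div_lt_iff₀ hs0]; push_cast; linarith
          omega
        have hk1' : (k h : ℝ) ≤ -1 := by exact_mod_cast hk1
        rw [abs_of_neg (by linarith)]
        exact ⟨by linarith, by nlinarith⟩
    obtain ⟨hk0, hk2⟩ := hkk
    have h5 : 1 / |u h| ≤ |u h| ^ (-(1 + δ)) := by
      rw [one_div, ← Real.rpow_neg_one]
      exact Real.rpow_le_rpow_of_exponent_ge hupos hu12 (by linarith)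
    refine h5.trans ?_
    have h6 : |u h| ^ (-(1 + δ)) ≤ (|(k h : ℝ)| * s / 2) ^ (-(1 + δ)) :=
      Real.rpow_le_rpow_of_nonpos (by positivity) hk2 (by linarith)
    refine h6.trans (le_of_eq ?_)
    rw [mul_div_assoc, Real.mul_rpow hk0.le (by positivity), mul_comm]
    congr 1
    rw [Real.rpow_neg (by positivity), ← Real.inv_rpow (by positivity), inv_div]
  refine (Finset.sum_le_sum hterm).trans ?_
  rw [← Finset.mul_sum]
  have hZs : ∑ h ∈ Finset.Icc 1 N, |(k h : ℝ)| ^ (-(1 + δ)) ≤ Z := by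
    rw [← Finset.sum_image (f := fun n : ℤ => |(n : ℝ)| ^ (-(1 + δ))) hinj]
    exact hsum.sum_le_tsum _ fun n _ => by positivity
  have h2s : (2 / s) ^ (1 + δ) = (2 / c) ^ (1 + δ) * (N : ℝ) ^ ((1 + δ) * (1 + δ)) := by
    have : 2 / s = 2 / c * (N : ℝ) ^ (1 + δ) := by
      rw [hs, Real.rpow_neg hN0.le]; field_simp
    rw [this, Real.mul_rpow (by positivity) (by positivity), ← Real.rpow_mul hN0.le]
  rw [h2s]
  have h7 : (N : ℝ) ^ ((1 + δ) * (1 + δ)) ≤ (N : ℝ) ^ (1 + ε) :=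
    Real.rpow_le_rpow_of_exponent_le hN1 hδε
  calc (2 / c) ^ (1 + δ) * (N : ℝ) ^ ((1 + δ) * (1 + δ)) * ∑ h ∈ Finset.Icc 1 N, |(k h : ℝ)| ^ (-(1 + δ))
      ≤ (2 / c) ^ (1 + δ) * (N : ℝ) ^ (1 + ε) * (Z + 1) := by
        gcongr
        linarith
    _ = _ := by ring

lemma sum_weighted (α : ℝ) (hirr : Irrational α) (halg : IsAlgebraic ℚ α) (ε : ℝ) (hε : 0 < ε) :
    ∃ C : ℝ, 0 < C ∧ ∀ N : ℕ,
      ∑ h ∈ Finset.Icc 1 N, (1 / (h : ℝ)) * (1 / nearestIntDist (α * (h : ℝ))) ≤ C * (N : ℝ) ^ ε := by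
  obtain ⟨C, hC, hsum⟩ := sum_recip α hirr halg ε hε
  have hnn : ∀ t, 0 ≤ nearestIntDist t := fun t => by rw [nid_eq]; positivity
  set θ : ℝ := (1 / 2 : ℝ) ^ ε with hθ
  have hθ1 : θ < 1 := Real.rpow_lt_one (by norm_num) (by norm_num) hε
  have hC' : 0 < 2 * C / (1 - θ) := div_pos (by linarith) (by linarith)
  refine ⟨2 * C / (1 - θ), hC', fun N => ?_⟩
  induction N using Nat.strong_induction_on with
  | _ N ih =>
    rcases Nat.eq_zero_or_pos N with h0 | hN
    · subst h0; simp only [zero_lt_one, Finset.Icc_eq_empty_of_lt, Finset.sum_empty]; positivity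
    have hN1 : (1 : ℝ) ≤ N := by exact_mod_cast hN
    have hN0 : (0 : ℝ) < N := by linarith
    have hih := ih (N / 2) (Nat.div_lt_self hN (by norm_num))
    have hsub : Finset.Icc 1 (N / 2) ⊆ Finset.Icc 1 N :=
      Finset.Icc_subset_Icc_right (Nat.div_le_self _ _)
    rw [← Finset.sum_sdiff hsub]
    have h1 : ∑ h ∈ Finset.Icc 1 N \ Finset.Icc 1 (N / 2),
        (1 / (h : ℝ)) * (1 / nearestIntDist (α * (h : ℝ))) ≤ 2 * C * (N : ℝ) ^ ε := by
      calc _ ≤ ∑ h ∈ Finset.Icc 1 N \ Finset.Icc 1 (N / 2),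
            (2 / (N : ℝ)) * (1 / nearestIntDist (α * (h : ℝ))) := by
            refine Finset.sum_le_sum fun h hh => ?_
            simp only [Finset.mem_sdiff, Finset.mem_Icc] at hh
            have h2 : N ≤ 2 * h := by omega
            have h3 : (N : ℝ) ≤ 2 * h := by exact_mod_cast h2
            refine mul_le_mul_of_nonneg_right ?_ (one_div_nonneg.mpr (hnn _))
            rw [div_le_div_iff₀ (by linarith) hN0]; linarith
        _ ≤ ∑ h ∈ Finset.Icc 1 N, (2 / (N : ℝ)) * (1 / nearestIntDist (α * (h : ℝ))) :=
            Finset.sum_le_sum_of_subset_of_nonneg Finset.sdiff_subset fun h _ _ =>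
              mul_nonneg (by positivity) (one_div_nonneg.mpr (hnn _))
        _ = (2 / (N : ℝ)) * ∑ h ∈ Finset.Icc 1 N, 1 / nearestIntDist (α * (h : ℝ)) := by
            rw [Finset.mul_sum]
        _ ≤ (2 / (N : ℝ)) * (C * (N : ℝ) ^ (1 + ε)) := by gcongr; exact hsum N hN
        _ = _ := by rw [Real.rpow_add hN0, Real.rpow_one]; field_simp
    have h2 : ((N / 2 : ℕ) : ℝ) ^ ε ≤ θ * (N : ℝ) ^ ε := by
      rw [hθ, ← Real.mul_rpow (by norm_num) hN0.le]
      apply Real.rpow_le_rpow (Nat.cast_nonneg _) _ hε.le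
      have := @Nat.cast_div_le ℝ _ _ _ N 2
      push_cast at this; linarith
    have h3 := mul_le_mul_of_nonneg_left h2 hC'.le
    have h4 : 2 * C * (N : ℝ) ^ ε + 2 * C / (1 - θ) * (θ * (N : ℝ) ^ ε) = 2 * C / (1 - θ) * (N : ℝ) ^ ε := by
      have : 1 - θ ≠ 0 := by linarith
      field_simp; ring
    linarith

end RothAux

theorem E_term_bound_irrational (a b : ℝ) (ha : 1 ≤ a) (hab : a < b)
    (halga : IsAlgebraic ℚ a) (halgb : IsAlgebraic ℚ b)
    (hirr : Irrational (a / b)) (ε : ℝ) (hε : 0 < ε) :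
    ∃ C > (0 : ℝ), ∀ x H : ℝ, 2 ≤ x → 2 ≤ H →
      ∑ h ∈ Finset.Icc 1 ⌊b * H⌋₊,
        (1 / (h : ℝ)) *
          min ((h : ℝ) ^ (-(1 : ℝ) / 2) * x ^ (1 / (2 * (a + b))))
            (1 / nearestIntDist ((a / b) * (h : ℝ)) +
              1 / nearestIntDist ((b / a) * (h : ℝ))) ≤
        C * x ^ (1 / (3 * (a + b))) * H ^ ε := by
  have hb : 0 < b := by linarith
  have halg1 : IsAlgebraic ℚ (a / b) := by
    rw [div_eq_mul_inv]; exact halga.mul halgb.inv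
  have halg2 : IsAlgebraic ℚ (b / a) := by
    rw [div_eq_mul_inv]; exact halgb.mul halga.inv
  have hirr2 : Irrational (b / a) := by
    rw [← inv_div]; exact hirr.inv
  obtain ⟨C1, hC1, h1⟩ := RothAux.sum_weighted _ hirr halg1 ε hε
  obtain ⟨C2, hC2, h2⟩ := RothAux.sum_weighted _ hirr2 halg2 ε hε
  refine ⟨(C1 + C2) * b ^ ε, by positivity, fun x H hx hH => ?_⟩
  have hx1 : 1 ≤ x ^ (1 / (3 * (a + b))) := by
    apply Real.one_le_rpow (by linarith)
    have : 0 < a + b := by linarith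
    positivity
  have hN : ((⌊b * H⌋₊ : ℕ) : ℝ) ^ ε ≤ b ^ ε * H ^ ε := by
    rw [← Real.mul_rpow hb.le (by linarith)]
    exact Real.rpow_le_rpow (Nat.cast_nonneg _) (Nat.floor_le (mul_nonneg hb.le (by linarith))) hε.le
  calc _ ≤ ∑ h ∈ Finset.Icc 1 ⌊b * H⌋₊, ((1 / (h : ℝ)) * (1 / nearestIntDist ((a / b) * (h : ℝ)))
        + (1 / (h : ℝ)) * (1 / nearestIntDist ((b / a) * (h : ℝ)))) := by
        refine Finset.sum_le_sum fun h _ => ?_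
        rw [← mul_add]
        exact mul_le_mul_of_nonneg_left (min_le_right _ _) (by positivity)
    _ ≤ C1 * ((⌊b * H⌋₊ : ℕ) : ℝ) ^ ε + C2 * ((⌊b * H⌋₊ : ℕ) : ℝ) ^ ε := by
        rw [Finset.sum_add_distrib]; exact add_le_add (h1 _) (h2 _)
    _ = (C1 + C2) * ((⌊b * H⌋₊ : ℕ) : ℝ) ^ ε := by ring
    _ ≤ (C1 + C2) * (b ^ ε * H ^ ε) := by gcongr
    _ = ((C1 + C2) * b ^ ε * H ^ ε) * 1 := by ring
    _ ≤ ((C1 + C2) * b ^ ε * H ^ ε) * x ^ (1 / (3 * (a + b))) := by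
        have : 0 ≤ H ^ ε := Real.rpow_nonneg (by linarith) _
        gcongr
    _ = _ := by ring
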